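/- arXiv:1810.04473 — 3 statements merged into one kernel-verified Lean document; each statement's English description precedes it below -/
import Mathlib

section
/- The graph H₂ satisfies ν_ur(H₂) = 6, i.e., its uniquely restricted matching number equals (n(H₂) − 2)/3. -/
open SimpleGraph

namespace URPaper

/-- `M` is a matching in the simple graph `G`: a finite set of edges of `G`
that are pairwise vertex-disjoint. -/
def IsMatchingSet {V : Type*} (G : SimpleGraph V) (M : Finset (Sym2 V)) : Prop :=
  (∀ e ∈ M, e ∈ G.edgeSet) ∧
    ∀ e ∈ M, ∀ f ∈ M, e ≠ f → ∀ v : V, v ∈ e → v ∉ f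

/-- The set of vertices covered by a set of edges. -/
def covered {V : Type*} (M : Finset (Sym2 V)) : Set V := {v | ∃ e ∈ M, v ∈ e}

/-- A matching `M` in `G` is uniquely restricted if no other matching of `G`
covers exactly the same set of vertices. -/
def IsURMatching {V : Type*} (G : SimpleGraph V) (M : Finset (Sym2 V)) : Prop :=
  IsMatchingSet G M ∧
    ∀ M' : Finset (Sym2 V), IsMatchingSet G M' → covered M' = covered M → M' = M

/-- The matching number `ν(G)`: the maximum size of a matching in `G`. -/
noncomputable def nu {V : Type*} (G : SimpleGraph V) : ℕ :=
  sSup {k | ∃ M : Finset (Sym2 V), IsMatchingSet G M ∧ M.card = k}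

/-- The uniquely restricted matching number `ν_ur(G)`: the maximum size of a
uniquely restricted matching in `G`. -/
noncomputable def nuUR {V : Type*} (G : SimpleGraph V) : ℕ :=
  sSup {k | ∃ M : Finset (Sym2 V), IsURMatching G M ∧ M.card = k}

/-- `D_G`: the set of vertices missed by at least one maximum matching of `G`. -/
def gallaiD {V : Type*} (G : SimpleGraph V) : Set V :=
  {v | ∃ M : Finset (Sym2 V), IsMatchingSet G M ∧ M.card = nu G ∧ v ∉ covered M}

/-- `A_G`: the set of vertices outside `D_G` having a neighbor in `D_G`. -/
def gallaiA {V : Type*} (G : SimpleGraph V) : Set V :=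
  {v | v ∉ gallaiD G ∧ ∃ u ∈ gallaiD G, G.Adj v u}

/-- `C_G = V(G) \ (A_G ∪ D_G)`. -/
def gallaiC {V : Type*} (G : SimpleGraph V) : Set V :=
  {v | v ∉ gallaiD G ∧ v ∉ gallaiA G}

/-- Membership in the family `𝒯`: trees `T` with `ν(T) = (n(T) - 1)/3`
(equivalently `3 ν(T) + 1 = n(T)`) such that every vertex of `A_T` has degree
at most `3` in `T`. -/
def MemT {V : Type*} (T : SimpleGraph V) : Prop :=
  T.IsTree ∧ (∀ v ∈ gallaiA T, (T.neighborSet v).ncard ≤ 3) ∧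
    3 * nu T + 1 = Nat.card V

/-- The graph obtained from `T` by contracting the set `S` to a single new
vertex (the vertex `none`), all other vertices being kept. -/
def contractSet {V : Type*} (T : SimpleGraph V) (S : Set V) :
    SimpleGraph (Option {x : V // x ∉ S}) where
  Adj a b :=
    match a, b with
    | some x, some y => T.Adj x y
    | some x, none => ∃ u ∈ S, T.Adj (x : V) u
    | none, some y => ∃ u ∈ S, T.Adj (y : V) u
    | none, none => False
  symm := by
    constructor
    rintro (_ | x) (_ | y) h
    · exact h
    · exact h
    · exact h
    · exact T.adj_symm h
  loopless := by
    constructor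
    rintro (_ | x) h
    · exact h
    · exact T.loopless.irrefl _ h

/-- The graph `BG1` from the paper, given by an explicit edge list. -/
def BG1 : SimpleGraph (Fin 10) :=
  SimpleGraph.fromEdgeSet {s(0,4), s(1,4), s(0,5), s(2,5), s(0,6), s(3,6), s(1,7), s(2,7), s(1,8), s(3,8), s(2,9), s(3,9)}

/-- The graph `BG2` from the paper, given by an explicit edge list. -/
def BG2 : SimpleGraph (Fin 13) :=
  SimpleGraph.fromEdgeSet {s(0,4), s(1,4), s(0,5), s(2,5), s(0,6), s(3,6), s(1,7), s(2,7), s(1,8), s(3,8), s(2,9), s(3,9), s(10,6), s(10,7), s(11,8), s(11,5), s(12,4), s(12,9)}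

/-- The graph `BG3` from the paper, given by an explicit edge list. -/
def BG3 : SimpleGraph (Fin 16) :=
  SimpleGraph.fromEdgeSet {s(0,1), s(1,2), s(2,3), s(3,4), s(4,5), s(5,0), s(6,7), s(7,8), s(8,9), s(9,10), s(10,11), s(11,6), s(12,0), s(12,6), s(13,2), s(13,8), s(14,4), s(14,10), s(15,12), s(15,13), s(15,14)}

/-- The graph `BG4` from the paper, given by an explicit edge list. -/
def BG4 : SimpleGraph (Fin 19) :=
  SimpleGraph.fromEdgeSet {s(0,1), s(1,2), s(2,3), s(3,4), s(4,5), s(5,0), s(6,7), s(7,8), s(8,9), s(9,10), s(10,11), s(11,6), s(12,0), s(13,1), s(14,2), s(15,3), s(16,4), s(17,5), s(12,6), s(13,7), s(14,8), s(15,9), s(16,10), s(17,11), s(18,12), s(18,14), s(18,16)}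

/-- The graph `BG5` from the paper, given by an explicit edge list. -/
def BG5 : SimpleGraph (Fin 16) :=
  SimpleGraph.fromEdgeSet {s(0,4), s(1,4), s(0,5), s(2,5), s(0,6), s(3,6), s(1,7), s(2,7), s(1,8), s(3,8), s(2,9), s(3,9), s(10,6), s(10,7), s(11,8), s(11,5), s(12,4), s(12,9), s(13,14), s(14,15), s(13,10), s(13,11), s(15,12)}

/-- The graph `BG6` from the paper, given by an explicit edge list. -/
def BG6 : SimpleGraph (Fin 19) :=
  SimpleGraph.fromEdgeSet {s(0,4), s(1,4), s(0,5), s(2,5), s(0,6), s(3,6), s(1,7), s(2,7), s(1,8), s(3,8), s(2,9), s(3,9), s(10,6), s(10,7), s(11,8), s(11,5), s(12,4), s(12,9), s(13,14), s(14,15), s(15,16), s(16,17), s(17,18), s(18,13), s(13,10), s(15,11), s(17,12)}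

/-- The graph `BG7` from the paper, given by an explicit edge list. -/
def BG7 : SimpleGraph (Fin 19) :=
  SimpleGraph.fromEdgeSet {s(0,1), s(1,2), s(2,3), s(3,4), s(4,5), s(5,0), s(6,7), s(7,8), s(8,9), s(9,10), s(10,11), s(11,6), s(12,0), s(12,6), s(13,2), s(13,8), s(14,4), s(14,10), s(15,12), s(15,13), s(15,14), s(17,16), s(16,18), s(17,9), s(17,5), s(18,3), s(18,11)}

/-- The graph `BG8` from the paper, given by an explicit edge list. -/
def BG8 : SimpleGraph (Fin 22) :=
  SimpleGraph.fromEdgeSet {s(0,1), s(1,2), s(2,3), s(3,4), s(4,5), s(5,0), s(6,7), s(7,8), s(8,9), s(9,10), s(10,11), s(11,6), s(12,0), s(13,1), s(14,2), s(15,3), s(16,4), s(17,5), s(12,6), s(13,7), s(14,8), s(15,9), s(16,10), s(17,11), s(18,12), s(18,14), s(18,16), s(19,20), s(20,21), s(19,13), s(19,15), s(21,17)}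

/-- The graph `BG9` from the paper, given by an explicit edge list. -/
def BG9 : SimpleGraph (Fin 25) :=
  SimpleGraph.fromEdgeSet {s(0,1), s(1,2), s(2,3), s(3,4), s(4,5), s(5,0), s(6,7), s(7,8), s(8,9), s(9,10), s(10,11), s(11,6), s(12,0), s(13,1), s(14,2), s(15,3), s(16,4), s(17,5), s(12,6), s(13,7), s(14,8), s(15,9), s(16,10), s(17,11), s(18,12), s(18,14), s(18,16), s(19,20), s(20,21), s(21,22), s(22,23), s(23,24), s(24,19), s(19,13), s(21,15), s(23,17)}

/-- The graph `GraphH1` from the paper, given by an explicit edge list. -/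
def GraphH1 : SimpleGraph (Fin 14) :=
  SimpleGraph.fromEdgeSet {s(0,4), s(1,4), s(0,5), s(2,5), s(0,6), s(3,6), s(1,7), s(2,7), s(1,8), s(3,8), s(2,9), s(3,9), s(10,6), s(10,7), s(11,8), s(11,5), s(12,4), s(12,9), s(13,10), s(13,11), s(13,12)}

/-- The graph `GraphH2` from the paper, given by an explicit edge list. -/
def GraphH2 : SimpleGraph (Fin 20) :=
  SimpleGraph.fromEdgeSet {s(0,1), s(1,2), s(2,3), s(3,4), s(4,5), s(5,0), s(6,7), s(7,8), s(8,9), s(9,10), s(10,11), s(11,6), s(12,0), s(13,1), s(14,2), s(15,3), s(16,4), s(17,5), s(12,6), s(13,7), s(14,8), s(15,9), s(16,10), s(17,11), s(18,12), s(18,14), s(18,16), s(19,13), s(19,15), s(19,17)}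

/-- Membership in the family `ℬ = {G₁, …, G₉}`, up to isomorphism. -/
def IsBlockB : ∀ (X : Type), SimpleGraph X → Prop := fun _ H =>
  Nonempty (H ≃g BG1) ∨ Nonempty (H ≃g BG2) ∨ Nonempty (H ≃g BG3) ∨
  Nonempty (H ≃g BG4) ∨ Nonempty (H ≃g BG5) ∨ Nonempty (H ≃g BG6) ∨
  Nonempty (H ≃g BG7) ∨ Nonempty (H ≃g BG8) ∨ Nonempty (H ≃g BG9)

/-- Membership in the family `ℬ_c = {G₁, G₂, G₃, G₄}`, up to isomorphism. -/
def IsBlockBc : ∀ (X : Type), SimpleGraph X → Prop := fun _ H =>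
  Nonempty (H ≃g BG1) ∨ Nonempty (H ≃g BG2) ∨ Nonempty (H ≃g BG3) ∨ Nonempty (H ≃g BG4)

/-- `G` (on vertex set `W`) arises from the tree `T` (on vertex set `V`) by
replacing every vertex of `S` by a graph from the family `𝓑`.  The map `π`
sends every vertex of `G` to the vertex of `T` it corresponds to:
* every fiber over a vertex outside `S` is a single vertex, and on these
  vertices `π` is an isomorphism with the corresponding induced subgraph of `T`;
* the fiber over a vertex `s ∈ S` induces a graph of the family `𝓑`;
* there are no edges between the fibers of two distinct vertices of `S`;
* for `s ∈ S` and `v ∉ S`, there is exactly one edge of `G` between the two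
  fibers if `sv ∈ E(T)` and none otherwise;
* each vertex of a fiber over `s ∈ S` has at most one neighbor outside this
  fiber (distinct attachment vertices), and a vertex of such a fiber having a
  neighbor outside the fiber has exactly two neighbors inside it
  (attachment only at vertices of degree `2` of the replacing graph). -/
def ArisesFrom (𝓑 : ∀ (X : Type), SimpleGraph X → Prop) {W V : Type}
    (G : SimpleGraph W) (T : SimpleGraph V) (S : Set V) (π : W → V) : Prop :=
  Function.Surjective π ∧
  (∀ v ∉ S, ∀ w w' : W, π w = v → π w' = v → w = w') ∧
  (∀ w w' : W, π w ∉ S → π w' ∉ S → (G.Adj w w' ↔ T.Adj (π w) (π w'))) ∧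
  (∀ s ∈ S, 𝓑 _ (G.induce (π ⁻¹' {s}))) ∧
  (∀ s ∈ S, ∀ s' ∈ S, s ≠ s' → ∀ w w' : W, π w = s → π w' = s' → ¬ G.Adj w w') ∧
  (∀ s ∈ S, ∀ v ∉ S, T.Adj s v →
    ∃! p : W × W, π p.1 = s ∧ π p.2 = v ∧ G.Adj p.1 p.2) ∧
  (∀ s ∈ S, ∀ v ∉ S, ¬ T.Adj s v →
    ∀ w w' : W, π w = s → π w' = v → ¬ G.Adj w w') ∧
  (∀ s ∈ S, ∀ w : W, π w = s → ∀ w₁ w₂ : W, π w₁ ≠ s → π w₂ ≠ s →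
    G.Adj w w₁ → G.Adj w w₂ → w₁ = w₂) ∧
  (∀ s ∈ S, ∀ w : W, π w = s → ∀ w' : W, π w' ≠ s → G.Adj w w' →
    (G.neighborSet w ∩ π ⁻¹' {s}).ncard = 2)

/-- Membership in the family `𝒢`: graphs arising from a tree `T ∈ 𝒯` by
replacing each vertex of a subset `S ⊆ D_T` by a graph of the family `ℬ`. -/
def InCalG {W : Type} (G : SimpleGraph W) : Prop :=
  ∃ (V : Type) (T : SimpleGraph V) (S : Set V) (π : W → V),
    Finite V ∧ MemT T ∧ S ⊆ gallaiD T ∧ ArisesFrom IsBlockB G T S π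

/-- `κ_G(P)`: the number of connected components of `G` whose induced graph
satisfies the (isomorphism invariant) predicate `P`. -/
noncomputable def kappa {W : Type} (G : SimpleGraph W)
    (P : ∀ (X : Type), SimpleGraph X → Prop) : ℕ :=
  Nat.card {c : G.ConnectedComponent // P _ (G.induce c.supp)}

/-- Membership in `𝒢₃`: cubic graphs of girth at least `5`. -/
def IsCubicGirth5 : ∀ (X : Type), SimpleGraph X → Prop := fun _ H =>
  (∀ v, (H.neighborSet v).ncard = 3) ∧ 5 ≤ H.egirth

/-- Being isomorphic to `H₁` or `H₂`. -/
def IsH1orH2 : ∀ (X : Type), SimpleGraph X → Prop := fun _ H =>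
  Nonempty (H ≃g GraphH1) ∨ Nonempty (H ≃g GraphH2)

def steps : List (ℕ × List (ℕ × ℕ × List (ℕ × ℕ))) := [
  (6, [(6, 7, []),
    (11, 11, []),
    (18, 12, [])]),
  (7, [(6, 6, []),
    (7, 8, []),
    (19, 13, [])]),
  (11, [(10, 10, []),
    (11, 6, []),
    (23, 17, [])]),
  (12, [(12, 0, []),
    (18, 6, []),
    (24, 18, [])]),
  (8, [(7, 7, []),
    (8, 9, [(1344, 2688)]),
    (20, 14, [(17825856, 33816704)])]),
  (13, [(13, 1, [(12352, 786433)]),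
    (19, 7, []),
    (27, 19, [(142606400, 537397248)])]),
  (10, [(9, 9, [(2688, 1344), (17828352, 33817856), (142606976, 537396480)]),
    (10, 11, []),
    (22, 16, [(20973568, 67372032), (20971840, 67371648)])]),
  (17, [(17, 5, [(137216, 8650784), (134352960, 537657376)]),
    (23, 11, []),
    (29, 19, [(537397248, 142606400), (536885248, 142868481), (537396480, 142606976)])]),
  (0, [(0, 1, [(134348801, 536879136), (786433, 12352), (18350081, 33566848), (657409, 8396896), (142868481, 536885248)]),
    (5, 5, [(536879136, 134348801), (8650784, 137216), (29360160, 67245056), (8396896, 657409), (537657376, 134352960)]),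
    (12, 12, [])]),
  (18, [(24, 12, []),
    (25, 14, [(37748992, 68157952), (33816704, 17825856), (37750912, 68158528), (33817856, 17828352), (33566848, 18350081)]),
    (26, 16, [(68157952, 37748992), (67372032, 20973568), (67371648, 20971840), (68158528, 37750912), (67245056, 29360160)])]),
  (9, [(8, 8, []),
    (9, 10, []),
    (21, 15, [(136315008, 268960000), (538969088, 276824576), (538970240, 276824384), (136315968, 268962304)])]),
  (14, [(14, 2, [(24704, 1572866), (16793601, 33558530), (278657, 1052738), (16801856, 34340866)]),
    (20, 8, []),
    (25, 18, [])]),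
  (1, [(0, 0, []),
    (1, 2, [(1572866, 24704), (33558530, 16793601), (137363458, 268460288), (1052738, 278657), (34340866, 16801856)]),
    (13, 13, [])]),
  (19, [(27, 13, []),
    (28, 15, [(268960000, 136315008), (276824576, 538969088), (268460288, 137363458), (276824384, 538970240), (268962304, 136315968)]),
    (29, 17, [])]),
  (16, [(16, 4, [(16842784, 67112976), (197632, 12582928), (33620002, 67125265), (268632576, 543162384), (16975872, 75759632), (328736, 4200464)]),
    (22, 10, []),
    (26, 18, [])]),
  (5, [(4, 4, [(67112976, 16842784), (12582928, 197632), (67125265, 33620002), (543162384, 268632576), (4200464, 328736), (75759632, 16975872)]),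
    (5, 0, []),
    (17, 17, [])]),
  (15, [(15, 3, [(134250498, 268443652), (49408, 3145732), (536903696, 268566536), (98816, 6291464), (536903714, 268566533), (134250513, 268443688), (67158528, 39845892), (557314, 2105476), (134267008, 270008324), (536970240, 281018376), (8421904, 2229256), (33652992, 70254600)]),
    (21, 9, []),
    (28, 19, [])]),
  (2, [(1, 1, []),
    (2, 3, [(21, 42), (268443652, 134250498), (33619972, 67125256), (3145732, 49408), (16842757, 67112970), (33558548, 16793640), (268566533, 536903714), (536879124, 134348810), (2105476, 557314), (1114628, 4210952), (39845892, 67158528), (270008324, 134267008)]),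
    (14, 14, [])]),
  (4, [(3, 3, [(42, 21), (67125256, 33619972), (268566536, 536903696), (6291464, 98816), (67112970, 16842757), (268443688, 134250513), (16793640, 33558548), (134348810, 536879124), (4210952, 1114628), (2229256, 8421904), (281018376, 536970240), (70254600, 33652992)]),
    (4, 5, []),
    (16, 16, [])]),
  (3, [(2, 2, []),
    (3, 4, []),
    (15, 15, [])])]

def leafs : List (ℕ × ℕ) := [(328709, 4200458), (4200458, 328709), (37186, 2359429), (2229253, 8421922), (8421922, 2229253), (23068677, 67146242), (67146242, 23068677), (277086213, 536909826), (149633, 9437282), (279809, 1055234), (1055234, 279809), (4210961, 1114658), (1114658, 4210961), (540016674, 268583169), (67257345, 46137378), (46137378, 67257345), (74848, 4720657), (8397472, 656641), (21496065, 67121792), (67121792, 21496065), (2105512, 557329), (68681745, 33628320), (151093249, 335556616), (154140673, 302002432), (302002432, 154140673), (268450304, 136578049), (268509728, 140509201), (603993088, 163577857), (278696, 1052756), (1052756, 278696), (19922984, 33591568), (33591568, 19922984), (269221928, 134254672), (167907456, 555221024), (553697312, 302125060), (302125060, 553697312), (657418, 8396884), (8396884, 657418), (146800650, 536945668), (536945668,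 146800650), (67895306, 16851012), (553674752, 176422914), (167968770, 604004368), (604004368, 167968770), (42205204, 16926728), (16926728, 42205204), (538443796, 134365320), (151044160, 302776324), (4720657, 74848), (656641, 8397472), (136578049, 268450304), (140509201, 268509728), (39440, 2360360), (134254672, 269221928), (328352, 4198736), (26214944, 33690880), (555221024, 167907456), (539230368, 268570944), (268570944, 539230368), (335680000, 559939616), (16851012, 67895306), (176422914, 553674752), (38275074, 67134528), (67134528, 38275074), (134365320, 538443796), (302776324, 151044160), (277872708, 536922240), (536922240, 277872708), (16875840, 69468296), (344195080, 553748480), (167870592, 337117192), (604766224, 151191616), (2359429, 37186), (536909826, 277086213), (9437282, 149633), (268583169, 540016674), (557329, 2105512), (33628320, 68681745), (335556616, 151093249), (163577857, 603993088), (2360360, 39440), (4198736, 328352), (33690880, 26214944), (559939616, 335680000), (4718858, 74372), (74372, 4718858), (559618, 2106436), (2106436, 559618), (143655426, 536896768), (536896768, 143655426), (174063618, 335569408), (335569408, 174063618), (9437716, 148744), (148744, 9437716), (1115204, 4212872), (4212872, 1115204), (35914756, 16828928), (16828928, 35914756), (314572804, 604029952), (604029952, 314572804), (2230408, 8421712),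 (8421712, 2230408), (273156104, 134317120), (134317120, 273156104), (69468296, 16875840), (553748480, 344195080), (337117192, 167870592), (76546128, 33753216), (33753216, 76546128), (151191616, 604766224), (541589776, 134414976), (134414976, 541589776), (607125520, 302186752), (302186752, 607125520), (157286464, 336331264), (336331264, 157286464), (556795904, 310640896), (310640896, 556795904), (180355200, 605553664), (605553664, 180355200), (328325, 4198730), (4198730, 328325), (2230405, 8421730), (8421730, 2230405), (297795589, 604017666), (604017666, 297795589), (4212881, 1115234), (1115234, 4212881), (277102849, 540022786), (540022786, 277102849), (335692289, 576716834), (576716834, 335692289), (559633, 2106472), (2106472, 559633), (17400065, 69218440), (69218440, 17400065), (68813825, 46145696), (46145696, 68813825), (134579201, 272644104), (272644104, 134579201), (204472337, 302063904), (302063904, 204472337), (160432641, 570438912), (570438912, 160432641), (279848, 1055252), (1055252, 279848), (286785576, 167809168), (167809168, 286785576), (269287968, 140513360), (140513360, 269287968), (25215520, 35787780), (35787780, 25215520), (558367008, 201462400), (201462400, 558367008), (537182368, 269619268), (269619268, 537182368), (656650, 8397460), (8397460, 656650), (209977354, 553723908), (553723908, 209977354), (67928578, 23076932), (23076932, 67928578),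 (135463426, 541090064), (541090064, 135463426), (170132482, 285239808), (285239808, 170132482), (34277378, 75522128), (75522128, 34277378), (571211796, 151142472), (151142472, 571211796), (538510340, 146817160), (146817160, 538510340), (306710532, 201376832), (201376832, 306710532), (20056072, 42238224), (42238224, 20056072), (344981576, 570525824), (570525824, 344981576), (606339216, 285409600), (285409600, 606339216)]

def edges : List (ℕ × ℕ) := [(0, 1), (1, 2), (2, 3), (3, 4), (4, 5), (0, 5), (6, 7), (7, 8), (8, 9), (9, 10), (10, 11), (6, 11), (0, 12), (1, 13), (2, 14), (3, 15), (4, 16), (5, 17), (6, 12), (7, 13), (8, 14), (9, 15), (10, 16), (11, 17), (12, 18), (14, 18), (16, 18), (13, 19), (15, 19), (17, 19)]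

noncomputable def anySub (c : ℕ) (l : List (ℕ × ℕ)) : Bool :=
  List.rec false (fun h _ ih => Bool.rec ih true (Nat.beq (Nat.land h.1 c) h.1)) l

def tb (d v : ℕ) : Bool := Nat.beq (Nat.land (Nat.shiftRight d v) (nat_lit 1)) (nat_lit 1)

noncomputable def search (l : List (ℕ × List (ℕ × ℕ × List (ℕ × ℕ)))) : ℕ → ℕ → ℕ → Bool :=
  List.rec (fun _ c _ => anySub c leafs)
    (fun s _ ih d c b =>
      Bool.rec
        (Bool.rec false
          (List.rec true (fun r _ ih2 =>
            Bool.rec false ih2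
              (Bool.rec
                (Bool.rec
                  (ih (Nat.lor (Nat.lor d (Nat.pow (nat_lit 2) s.1)) (Nat.pow (nat_lit 2) r.2.1))
                    (Nat.lor c (Nat.pow (nat_lit 2) r.1)) b)
                  true (anySub (Nat.lor c (Nat.pow (nat_lit 2) r.1)) r.2.2))
                true (tb d r.2.1))) s.2)
          (Bool.rec (ih (Nat.lor d (Nat.pow (nat_lit 2) s.1)) c (Nat.pred b)) true
            (Nat.beq b (nat_lit 0))))
        (ih d c b) (tb d s.1)) l

def Ed (i : ℕ) : Sym2 (Fin 20) :=
  s(Fin.ofNat 20 (edges.getD i (0, 0)).1, Fin.ofNat 20 (edges.getD i (0, 0)).2)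

def inc (s : ℕ × List (ℕ × ℕ × List (ℕ × ℕ))) : List ℕ := s.2.map (fun r => r.1)

def valid (p : ℕ × ℕ) : Bool :=
  (steps.all fun s =>
    ((inc s).any (tb p.1) == (inc s).any (tb p.2)) &&
    ((inc s).all fun i => (inc s).all fun j => !tb p.2 i || (!tb p.2 j || Nat.beq i j))) &&
  (List.range 30).any fun i => tb p.1 i && !tb p.2 i

theorem search_ok : search steps 0 0 6 = true := by decide +kernel

theorem valid_leafs : leafs.all valid = true := by decide +kernel

theorem valid_steps : (steps.all fun s => s.2.all fun r => r.2.2.all valid) = true := by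
  decide +kernel

theorem inc_ok : ∀ v : Fin 20, ∃ s ∈ steps, s.1 = v.val ∧
    ∀ i ∈ List.range 30, (v ∈ Ed i ↔ i ∈ inc s) := by decide +kernel

theorem steps_ok : ∀ s ∈ steps, s.1 < 20 ∧ (∀ r ∈ s.2, r.1 < 30 ∧ r.2.1 < 20 ∧
      Ed r.1 = s(Fin.ofNat 20 s.1, Fin.ofNat 20 r.2.1)) ∧
      ∀ i ∈ List.range 30, Fin.ofNat 20 s.1 ∈ Ed i → i ∈ inc s := by decide +kernel

theorem steps_nodup : (steps.map fun s => Fin.ofNat 20 s.1).Nodup := by decide +kernel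

theorem edgeSet_eq : GraphH2.edgeSet = {e | ∃ i < 30, Ed i = e} := by
  have h1 : ∀ i < 30, Ed i ∈ (({s(0,1), s(1,2), s(2,3), s(3,4), s(4,5), s(5,0), s(6,7), s(7,8), s(8,9), s(9,10), s(10,11), s(11,6), s(12,0), s(13,1), s(14,2), s(15,3), s(16,4), s(17,5), s(12,6), s(13,7), s(14,8), s(15,9), s(16,10), s(17,11), s(18,12), s(18,14), s(18,16), s(19,13), s(19,15), s(19,17)} : Finset (Sym2 (Fin 20)))) ∧ ¬ (Ed i).IsDiag := by
    decide +kernel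
  have h2 : ∀ e ∈ (({s(0,1), s(1,2), s(2,3), s(3,4), s(4,5), s(5,0), s(6,7), s(7,8), s(8,9), s(9,10), s(10,11), s(11,6), s(12,0), s(13,1), s(14,2), s(15,3), s(16,4), s(17,5), s(12,6), s(13,7), s(14,8), s(15,9), s(16,10), s(17,11), s(18,12), s(18,14), s(18,16), s(19,13), s(19,15), s(19,17)} : Finset (Sym2 (Fin 20)))), ∃ i < 30, Ed i = e := by
    decide +kernel
  unfold GraphH2
  rw [SimpleGraph.edgeSet_fromEdgeSet]
  ext e
  simp only [Set.mem_sdiff, Set.mem_ofPred_eq]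
  constructor
  · rintro ⟨h, -⟩
    apply h2
    simpa using h
  · rintro ⟨i, hi, rfl⟩
    have := h1 i hi
    refine ⟨?_, by simpa using this.2⟩
    simpa using this.1

theorem Ed_inj : ∀ i < 30, ∀ j < 30, Ed i = Ed j → i = j := by decide +kernel

theorem tb_eq (d v : ℕ) : tb d v = d.testBit v := by
  have h : tb d v = decide ((d >>> v) &&& 1 = 1) := by
    rw [Bool.eq_iff_iff, decide_eq_true_iff]
    exact iff_of_eq Nat.beq_eq
  rw [h, Nat.testBit, Nat.and_comm 1, Nat.and_one_is_mod]
  rcases Nat.mod_two_eq_zero_or_one (d >>> v) with h | h <;> rw [h] <;> rfl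

theorem not_ur {V : Type*} [DecidableEq V] {G : SimpleGraph V} {M H H' : Finset (Sym2 V)}
    (hM : IsURMatching G M)
    (HM : H ⊆ M) (h' : IsMatchingSet G H') (hc : covered H' = covered H)
    (e : Sym2 V) (he : e ∈ H) (he' : e ∉ H') : False := by
  obtain ⟨⟨m1, m2⟩, hu⟩ := hM
  have key : ∀ a ∈ M, a ∉ H → ∀ b ∈ H', ∀ v, v ∈ a → v ∈ b → False := by
    intro a ha haH b hb v hva hvb
    have : v ∈ covered H := hc ▸ ⟨b, hb, hvb⟩
    obtain ⟨f, hf, hvf⟩ := this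
    exact m2 a ha f (HM hf) (fun h => haH (h ▸ hf)) v hva hvf
  have := hu ((M \ H) ∪ H') ⟨?_, ?_⟩ ?_
  · have h2 : e ∈ (M \ H) ∪ H' := by rw [this]; exact HM he
    simp at h2
    tauto
  · intro a ha
    rcases Finset.mem_union.1 ha with ha | ha
    · exact m1 a (Finset.mem_sdiff.1 ha).1
    · exact h'.1 a ha
  · intro a ha b hb hab v hva hvb
    rcases Finset.mem_union.1 ha with ha | ha <;> rcases Finset.mem_union.1 hb with hb | hb
    · exact m2 a (Finset.mem_sdiff.1 ha).1 b (Finset.mem_sdiff.1 hb).1 hab v hva hvb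
    · exact key a (Finset.mem_sdiff.1 ha).1 (Finset.mem_sdiff.1 ha).2 b hb v hva hvb
    · exact key b (Finset.mem_sdiff.1 hb).1 (Finset.mem_sdiff.1 hb).2 a ha v hvb hva
    · exact h'.2 a ha b hb hab v hva hvb
  · ext v
    constructor
    · rintro ⟨a, ha, hv⟩
      rcases Finset.mem_union.1 ha with ha | ha
      · exact ⟨a, (Finset.mem_sdiff.1 ha).1, hv⟩
      · have : v ∈ covered H := hc ▸ ⟨a, ha, hv⟩
        obtain ⟨f, hf, hvf⟩ := this
        exact ⟨f, HM hf, hvf⟩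
    · rintro ⟨a, ha, hv⟩
      by_cases haH : a ∈ H
      · have : v ∈ covered H' := hc ▸ ⟨a, haH, hv⟩
        obtain ⟨f, hf, hvf⟩ := this
        exact ⟨f, Finset.mem_union_right _ hf, hvf⟩
      · exact ⟨a, Finset.mem_union_left _ (Finset.mem_sdiff.2 ⟨ha, haH⟩), hv⟩

def mset (h : ℕ) : Finset (Sym2 (Fin 20)) :=
  ((Finset.range 30).filter (fun i => tb h i = true)).image Ed

theorem mem_mset {h : ℕ} {e : Sym2 (Fin 20)} :
    e ∈ mset h ↔ ∃ i, (i < 30 ∧ tb h i = true) ∧ Ed i = e := by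
  simp [mset]

theorem mem_cov {h : ℕ} {v : Fin 20} {s} (hs : ∀ i ∈ List.range 30, (v ∈ Ed i ↔ i ∈ inc s))
    (hs' : s ∈ steps) :
    v ∈ covered (mset h) ↔ (inc s).any (tb h) = true := by
  constructor
  · rintro ⟨e, he, hv⟩
    obtain ⟨i, ⟨hi, ht⟩, rfl⟩ := mem_mset.1 he
    exact List.any_eq_true.2 ⟨i, (hs i (List.mem_range.2 hi)).1 hv, ht⟩
  · intro hh
    obtain ⟨i, hi, ht⟩ := List.any_eq_true.1 hh
    have hlt : i < 30 := by
      obtain ⟨r, hr, rfl⟩ := List.mem_map.1 hi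
      exact ((steps_ok s hs').2.1 r hr).1
    exact ⟨Ed i, mem_mset.2 ⟨i, ⟨hlt, ht⟩, rfl⟩, (hs i (List.mem_range.2 hlt)).2 hi⟩

theorem bad {M : Finset (Sym2 (Fin 20))} (hM : IsURMatching GraphH2 M) {p : ℕ × ℕ}
    (hv : valid p = true) (hp : ∀ i, tb p.1 i = true → Ed i ∈ M) : False := by
  unfold valid at hv
  rw [Bool.and_eq_true, List.all_eq_true, List.any_eq_true] at hv
  obtain ⟨h1, i, hi, h2⟩ := hv
  rw [Bool.and_eq_true] at h2
  have hi := List.mem_range.1 hi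
  refine not_ur hM (H := mset p.1) (H' := mset p.2) ?_ ⟨?_, ?_⟩ ?_ (Ed i) ?_ ?_
  · intro e he
    obtain ⟨j, ⟨_, hj⟩, rfl⟩ := mem_mset.1 he
    exact hp j hj
  · intro e he
    obtain ⟨j, ⟨hj, _⟩, rfl⟩ := mem_mset.1 he
    rw [edgeSet_eq]
    exact ⟨j, hj, rfl⟩
  · intro a ha b hb hab v hva hvb
    obtain ⟨j, ⟨hj, htj⟩, rfl⟩ := mem_mset.1 ha
    obtain ⟨k, ⟨hk, htk⟩, rfl⟩ := mem_mset.1 hb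
    obtain ⟨s, hs, -, hinc⟩ := inc_ok v
    have h3 := h1 s hs
    rw [Bool.and_eq_true] at h3
    have h4 := List.all_eq_true.1 (List.all_eq_true.1 h3.2 j
      ((hinc j (List.mem_range.2 hj)).1 hva)) k ((hinc k (List.mem_range.2 hk)).1 hvb)
    rw [htj, htk] at h4
    simp at h4
    exact hab (by rw [h4])
  · ext v
    obtain ⟨s, hs, -, hinc⟩ := inc_ok v
    have h3 := h1 s hs
    rw [Bool.and_eq_true, beq_iff_eq] at h3
    rw [mem_cov hinc hs, mem_cov hinc hs, h3.1]
  · exact mem_mset.2 ⟨i, ⟨hi, h2.1⟩, rfl⟩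
  · intro h
    obtain ⟨j, ⟨hj, htj⟩, hji⟩ := mem_mset.1 h
    have := Ed_inj j hj i hi hji
    subst this
    simp [htj] at h2

theorem anySub_spec {c : ℕ} {l : List (ℕ × ℕ)} (h : anySub c l = true) :
    ∃ p ∈ l, ∀ i, tb p.1 i = true → tb c i = true := by
  induction l with
  | nil => exact absurd h (by simp [anySub])
  | cons a t ih =>
    have e : anySub c (a :: t) =
      Bool.rec (anySub c t) true (Nat.beq (Nat.land a.1 c) a.1) := rfl
    rw [e] at h
    cases hb : Nat.beq (Nat.land a.1 c) a.1 with
    | false =>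
      rw [hb] at h
      obtain ⟨p, hp, hh⟩ := ih h
      exact ⟨p, List.mem_cons_of_mem _ hp, hh⟩
    | true =>
      refine ⟨a, List.mem_cons_self, fun i hi => ?_⟩
      have h1 : a.1 &&& c = a.1 := Nat.eq_of_beq_eq_true hb
      rw [tb_eq] at hi ⊢
      rw [← h1, Nat.testBit_land, Bool.and_eq_true] at hi
      exact hi.2

theorem tb_lor (c i j : ℕ) : tb (Nat.lor c (Nat.pow 2 i)) j = true ↔ tb c j = true ∨ i = j := by
  have : Nat.lor c (Nat.pow 2 i) = c ||| 2 ^ i := rfl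
  rw [this, tb_eq, tb_eq, Nat.testBit_or, Bool.or_eq_true, Nat.testBit_two_pow]
  simp

def branches (ih : ℕ → ℕ → ℕ → Bool) (v d c b : ℕ) (l : List (ℕ × ℕ × List (ℕ × ℕ))) : Prop :=
  ∀ r ∈ l, tb d r.2.1 = true ∨ anySub (Nat.lor c (Nat.pow 2 r.1)) r.2.2 = true ∨
    ih (Nat.lor (Nat.lor d (Nat.pow 2 v)) (Nat.pow 2 r.2.1)) (Nat.lor c (Nat.pow 2 r.1)) b = true

theorem search_cons {s t d c b} (h : search (s :: t) d c b = true) :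
    (tb d s.1 = true ∧ search t d c b = true) ∨
    (tb d s.1 = false ∧ (b = 0 ∨ search t (Nat.lor d (Nat.pow 2 s.1)) c (b - 1) = true) ∧
      branches (search t) s.1 d c b s.2) := by
  have e : search (s :: t) d c b = Bool.rec
        (Bool.rec false
          (List.rec true (fun r _ ih2 =>
            Bool.rec false ih2
              (Bool.rec
                (Bool.rec
                  (search t (Nat.lor (Nat.lor d (Nat.pow 2 s.1)) (Nat.pow 2 r.2.1))
                    (Nat.lor c (Nat.pow 2 r.1)) b)
                  true (anySub (Nat.lor c (Nat.pow 2 r.1)) r.2.2))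
                true (tb d r.2.1))) s.2)
          (Bool.rec (search t (Nat.lor d (Nat.pow 2 s.1)) c (b - 1)) true
            (Nat.beq b 0)))
        (search t d c b) (tb d s.1) := rfl
  rw [e] at h
  clear e
  cases h1 : tb d s.1 with
  | true => rw [h1] at h; exact Or.inl ⟨rfl, h⟩
  | false =>
    right
    rw [h1] at h
    refine ⟨rfl, ?_⟩
    generalize hx : (Bool.rec (search t (Nat.lor d (Nat.pow 2 s.1)) c (b - 1)) true
            (Nat.beq b 0) : Bool) = x at h
    cases x with
    | false => exact absurd h (by simp)
    | true =>
      constructor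
      · cases hb : Nat.beq b 0 with
        | true => exact Or.inl (Nat.eq_of_beq_eq_true hb)
        | false => rw [hb] at hx; exact Or.inr hx
      · clear hx
        replace h : (List.rec true (fun r _ ih2 =>
            Bool.rec false ih2
              (Bool.rec
                (Bool.rec
                  (search t (Nat.lor (Nat.lor d (Nat.pow 2 s.1)) (Nat.pow 2 r.2.1))
                    (Nat.lor c (Nat.pow 2 r.1)) b)
                  true (anySub (Nat.lor c (Nat.pow 2 r.1)) r.2.2))
                true (tb d r.2.1))) s.2 : Bool) = true := h
        generalize s.2 = l at h
        induction l with
        | nil => intro r hr; exact absurd hr (by simp)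
        | cons r l ih =>
          dsimp only at h
          generalize hx : (Bool.rec
                (Bool.rec
                  (search t (Nat.lor (Nat.lor d (Nat.pow 2 s.1)) (Nat.pow 2 r.2.1))
                    (Nat.lor c (Nat.pow 2 r.1)) b)
                  true (anySub (Nat.lor c (Nat.pow 2 r.1)) r.2.2))
                true (tb d r.2.1) : Bool) = x at h
          cases x with
          | false => exact absurd h (by simp)
          | true =>
            intro r' hr'
            rcases List.mem_cons.1 hr' with rfl | hr'
            · cases h2 : tb d r'.2.1 with
              | true => exact Or.inl rfl
              | false =>
                right
                rw [h2] at hx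
                cases h3 : anySub (Nat.lor c (Nat.pow 2 r'.1)) r'.2.2 with
                | true => exact Or.inl rfl
                | false => rw [h3] at hx; exact Or.inr hx
            · exact ih h r' hr'

open Classical in
theorem search_sound {M : Finset (Sym2 (Fin 20))} (hM : IsURMatching GraphH2 M)
    (l : List (ℕ × List (ℕ × ℕ × List (ℕ × ℕ)))) (hl : ∀ s ∈ l, s ∈ steps) :
    ∀ (d c b : ℕ), (∀ i, tb c i = true → Ed i ∈ M) →
    (∀ x y : Fin 20, s(x, y) ∈ M → tb d x.val = true → tb d y.val = true) →
    (l.map fun s => Fin.ofNat 20 s.1).countP (fun v => decide (v ∉ covered M)) ≤ b →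
    search l d c b = true → False := by
  induction l with
  | nil =>
    intro d c b hc _ _ h
    obtain ⟨p, hp, hh⟩ := anySub_spec (c := c) (l := leafs) h
    exact bad hM (List.all_eq_true.1 valid_leafs p hp) (fun i hi => hc i (hh i hi))
  | cons s t ih =>
    intro d c b hc hd hb h
    replace ih := ih (fun s hs => hl s (List.mem_cons_of_mem _ hs))
    have hs := hl s List.mem_cons_self
    obtain ⟨hv, hr, hi⟩ := steps_ok s hs
    rw [List.map_cons, List.countP_cons] at hb
    have hval : (Fin.ofNat 20 s.1).val = s.1 := Nat.mod_eq_of_lt hv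
    rcases search_cons h with ⟨-, h2⟩ | ⟨h1, h2, h3⟩
    · exact ih d c b hc hd (by omega) h2
    · by_cases hcov : Fin.ofNat 20 s.1 ∈ covered M
      · obtain ⟨e, he, hve⟩ := hcov
        have hE := hM.1.1 e he
        rw [edgeSet_eq] at hE
        obtain ⟨i, hi30, rfl⟩ := hE
        obtain ⟨r, hrs, rfl⟩ := List.mem_map.1 (hi i (List.mem_range.2 hi30) hve)
        obtain ⟨-, hw, hEd⟩ := hr r hrs
        have hwal : (Fin.ofNat 20 r.2.1).val = r.2.1 := Nat.mod_eq_of_lt hw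
        have hc' : ∀ i, tb (Nat.lor c (Nat.pow 2 r.1)) i = true → Ed i ∈ M := by
          intro i hi
          rcases (tb_lor _ _ _).1 hi with hi | rfl
          · exact hc i hi
          · exact he
        rcases h3 r hrs with h4 | h4 | h4
        · have := hd (Fin.ofNat 20 r.2.1) (Fin.ofNat 20 s.1)
            (by rw [Sym2.eq_swap, ← hEd]; exact he) (by rw [hwal]; exact h4)
          rw [hval, h1] at this
          exact absurd this (by simp)
        · obtain ⟨p, hp, hh⟩ := anySub_spec h4
          refine bad hM (p := p) ?_ (fun i hi => hc' i (hh i hi))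
          exact List.all_eq_true.1 (List.all_eq_true.1
            (List.all_eq_true.1 valid_steps s hs) r hrs) p hp
        · refine ih _ _ b hc' ?_ (by omega) h4
          intro x y hxy hx
          have huniq : ∀ z : Fin 20, z ∈ s(x, y) → z ∈ Ed r.1 → s(x, y) = Ed r.1 := by
            intro z hz hz'
            by_contra hne
            exact hM.1.2 _ hxy _ he hne z hz hz'
          have fin : s(x, y) = Ed r.1 → tb (Nat.lor (Nat.lor d (Nat.pow 2 s.1))
              (Nat.pow 2 r.2.1)) y.val = true := by
            intro heq
            have hy : y ∈ Ed r.1 := heq ▸ Sym2.mem_mk_right x y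
            rw [hEd, Sym2.mem_iff] at hy
            rw [tb_lor, tb_lor]
            rcases hy with rfl | rfl
            · left; right; exact hval.symm
            · right; exact hwal.symm
          rw [tb_lor, tb_lor] at hx
          rcases hx with (hx | hx) | hx
          · rw [tb_lor, tb_lor]
            exact Or.inl (Or.inl (hd x y hxy hx))
          · apply fin
            apply huniq x (Sym2.mem_mk_left x y)
            have : x = Fin.ofNat 20 s.1 := Fin.ext (by rw [hval, hx])
            rw [this, hEd]; exact Sym2.mem_mk_left _ _
          · apply fin
            apply huniq x (Sym2.mem_mk_left x y)
            have : x = Fin.ofNat 20 r.2.1 := Fin.ext (by rw [hwal, hx])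
            rw [this, hEd]; exact Sym2.mem_mk_right _ _
      · rw [if_pos (by simpa using hcov)] at hb
        rcases h2 with rfl | h2
        · omega
        · refine ih _ c (b - 1) hc ?_ (by omega) h2
          intro x y hxy hx
          rw [tb_lor] at hx ⊢
          rcases hx with hx | hx
          · exact Or.inl (hd x y hxy hx)
          · exfalso
            apply hcov
            have : x = Fin.ofNat 20 s.1 := Fin.ext (by rw [hval, hx])
            exact ⟨_, hxy, this ▸ Sym2.mem_mk_left x y⟩

theorem card_cov {M : Finset (Sym2 (Fin 20))} (hM : IsMatchingSet GraphH2 M) :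
    (M.biUnion Sym2.toFinset).card = 2 * M.card := by
  rw [Finset.card_biUnion]
  · rw [Finset.sum_congr rfl (g := fun _ => 2), Finset.sum_const, smul_eq_mul, mul_comm]
    intro e he
    exact Sym2.card_toFinset_of_not_isDiag e
      (GraphH2.not_isDiag_of_mem_edgeSet (hM.1 e he))
  · intro a ha b hb hab
    show Disjoint _ _
    rw [Finset.disjoint_left]
    intro v hva hvb
    exact hM.2 a ha b hb hab v (Sym2.mem_toFinset.1 hva) (Sym2.mem_toFinset.1 hvb)

open Classical in
theorem upper {M : Finset (Sym2 (Fin 20))} (hM : IsURMatching GraphH2 M) : M.card ≤ 6 := by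
  by_contra hlt
  refine search_sound hM steps (fun s h => h) 0 0 6 ?_ ?_ ?_ search_ok
  · intro i hi
    rw [tb_eq] at hi
    simp at hi
  · intro x y _ hi
    rw [tb_eq] at hi
    simp at hi
  · rw [List.countP_eq_length_filter]
    have hn := steps_nodup.filter (fun v => decide (v ∉ covered M))
    rw [← List.toFinset_card_of_nodup hn]
    have hsub : (List.filter (fun v => decide (v ∉ covered M))
        (steps.map fun s => Fin.ofNat 20 s.1)).toFinset ⊆ (M.biUnion Sym2.toFinset)ᶜ := by
      intro v hv
      rw [List.mem_toFinset, List.mem_filter] at hv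
      have h2 := of_decide_eq_true hv.2
      rw [Finset.mem_compl, Finset.mem_biUnion]
      rintro ⟨e, he, hve⟩
      exact h2 ⟨e, he, Sym2.mem_toFinset.1 hve⟩
    have h3 := Finset.card_le_card hsub
    rw [Finset.card_compl, card_cov hM.1, Fintype.card_fin] at h3
    omega

def M6 : Finset (Sym2 (Fin 20)) := {s(6,7), s(8,9), s(16,4), s(3,2), s(1,0), s(5,17)}

def covM6 : List (Fin 20) := [6, 7, 8, 9, 16, 4, 3, 2, 1, 0, 5, 17]

theorem mem_covM6 : ∀ v : Fin 20, v ∈ covM6 ↔ ∃ e ∈ M6, v ∈ e := by decide +kernel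

theorem nbrs (v : Fin 20) (l : List (Fin 20))
    (h : ∀ i ∈ List.range 30, v ∈ Ed i →
      (∃ w ∈ l, Ed i = s(v, w)) ∨ ∃ x ∈ [10, 11, 12, 13, 14, 15, 18, 19], x ∈ Ed i)
    {M : Finset (Sym2 (Fin 20))} (hM : IsMatchingSet GraphH2 M)
    (hc : covered M = covered M6) (hv : v ∈ covM6) : ∃ w ∈ l, s(v, w) ∈ M := by
  have h1 : v ∈ covered M := hc ▸ (mem_covM6 v).1 hv
  obtain ⟨e, he, hve⟩ := h1
  have hE := hM.1 e he
  rw [edgeSet_eq] at hE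
  obtain ⟨i, hi, rfl⟩ := hE
  rcases h i (List.mem_range.2 hi) hve with ⟨w, hw, heq⟩ | ⟨x, hx, hxe⟩
  · exact ⟨w, hw, heq ▸ he⟩
  · exfalso
    have hall : ∀ x ∈ ([10, 11, 12, 13, 14, 15, 18, 19] : List (Fin 20)), x ∉ covM6 := by decide
    apply hall x hx
    rw [mem_covM6]
    have : x ∈ covered M := ⟨_, he, hxe⟩
    rw [hc] at this
    exact this

theorem excl {M : Finset (Sym2 (Fin 20))} (hM : IsMatchingSet GraphH2 M) {a b c : Fin 20}
    (h : s(a, b) ∈ M) (h' : s(c, b) ∈ M) (hne : s(a, b) ≠ s(c, b)) : False :=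
  hM.2 _ h _ h' hne b (Sym2.mem_mk_right _ _) (Sym2.mem_mk_right _ _)

theorem lower : IsURMatching GraphH2 M6 := by
  refine ⟨⟨?_, by decide +kernel⟩, ?_⟩
  · rw [edgeSet_eq]
    show ∀ e ∈ M6, ∃ i < 30, Ed i = e
    decide +kernel
  · intro M hM hc
    have e1 : s(6, 7) ∈ M := by
      obtain ⟨w, hw, h⟩ := nbrs 6 [7] (by decide +kernel) hM hc (by decide)
      simp only [List.mem_cons, List.not_mem_nil, or_false] at hw
      rwa [hw] at h
    have e2 : s(8, 9) ∈ M := by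
      obtain ⟨w, hw, h⟩ := nbrs 8 [7, 9] (by decide +kernel) hM hc (by decide)
      simp only [List.mem_cons, List.not_mem_nil, or_false] at hw
      rcases hw with rfl | rfl
      · exact (excl hM h e1 (by decide)).elim
      · exact h
    have e3 : s(16, 4) ∈ M := by
      obtain ⟨w, hw, h⟩ := nbrs 16 [4] (by decide +kernel) hM hc (by decide)
      simp only [List.mem_cons, List.not_mem_nil, or_false] at hw
      rwa [hw] at h
    have e4 : s(3, 2) ∈ M := by
      obtain ⟨w, hw, h⟩ := nbrs 3 [2, 4] (by decide +kernel) hM hc (by decide)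
      simp only [List.mem_cons, List.not_mem_nil, or_false] at hw
      rcases hw with rfl | rfl
      · exact h
      · exact (excl hM h e3 (by decide)).elim
    have e5 : s(1, 0) ∈ M := by
      obtain ⟨w, hw, h⟩ := nbrs 1 [0, 2] (by decide +kernel) hM hc (by decide)
      simp only [List.mem_cons, List.not_mem_nil, or_false] at hw
      rcases hw with rfl | rfl
      · exact h
      · exact (excl hM h e4 (by decide)).elim
    have e6 : s(5, 17) ∈ M := by
      obtain ⟨w, hw, h⟩ := nbrs 5 [4, 0, 17] (by decide +kernel) hM hc (by decide)
      simp only [List.mem_cons, List.not_mem_nil, or_false] at hw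
      rcases hw with rfl | rfl | rfl
      · exact (excl hM h e3 (by decide)).elim
      · exact (excl hM h e5 (by decide)).elim
      · exact h
    have hsub : M6 ⊆ M := by
      intro e he
      simp only [M6, Finset.mem_insert, Finset.mem_singleton] at he
      rcases he with rfl | rfl | rfl | rfl | rfl | rfl <;> assumption
    refine Finset.Subset.antisymm ?_ hsub
    intro e he
    have hcov : ∀ v ∈ e, ∃ f ∈ M6, v ∈ f := by
      intro v hv
      have : v ∈ covered M := ⟨e, he, hv⟩
      rw [hc] at this
      exact this
    induction e using Sym2.ind with
    | _ x y =>
      obtain ⟨f, hf, hxf⟩ := hcov x (Sym2.mem_mk_left x y)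
      by_contra hne
      exact hM.2 _ he f (hsub hf) (fun h => hne (h ▸ hf)) x (Sym2.mem_mk_left x y) hxf

/-- The graph `H₂` satisfies `ν_ur(H₂) = 6 = (n(H₂) - 2)/3`. -/
theorem statement3 : nuUR GraphH2 = 6 := by
  have h6 : 6 ∈ {k | ∃ M : Finset (Sym2 (Fin 20)), IsURMatching GraphH2 M ∧ M.card = k} :=
    ⟨M6, lower, by decide +kernel⟩
  have hub : ∀ k ∈ {k | ∃ M : Finset (Sym2 (Fin 20)), IsURMatching GraphH2 M ∧ M.card = k},
      k ≤ 6 := by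
    rintro k ⟨M, hM, rfl⟩
    exact upper hM
  exact le_antisymm (csSup_le ⟨6, h6⟩ hub) (le_csSup ⟨6, hub⟩ h6)

end URPaper
end

section
/- If T is a tree in which every vertex of A_T has degree at most 3, then ν(T) ≥ (n(T) − 1)/3. -/
open SimpleGraph

namespace URPaper

theorem card_le_nu {V : Type} [Fintype V] (T : SimpleGraph V) (M : Finset (Sym2 V))
    (hM : IsMatchingSet T M) : M.card ≤ nu T := by
  classical
  apply le_csSup
  · refine ⟨Fintype.card (Sym2 V), ?_⟩
    rintro k ⟨M, -, rfl⟩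
    exact Finset.card_le_univ M
  · exact ⟨M, hM, rfl⟩

theorem exists_max {V : Type} [Fintype V] (T : SimpleGraph V) :
    ∃ M : Finset (Sym2 V), IsMatchingSet T M ∧ M.card = nu T := by
  classical
  have : nu T ∈ {k | ∃ M : Finset (Sym2 V), IsMatchingSet T M ∧ M.card = k} := by
    apply Nat.sSup_mem
    · exact ⟨0, ∅, by simp [IsMatchingSet], rfl⟩
    · refine ⟨Fintype.card (Sym2 V), ?_⟩
      rintro k ⟨M, -, rfl⟩
      exact Finset.card_le_univ M
  exact this

open Classical in
/-- Edges of `M` meeting `S` together with edges of `N` avoiding `S`. -/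
noncomputable def mix {V : Type} (S : Set V) (M N : Finset (Sym2 V)) : Finset (Sym2 V) :=
  M.filter (fun e => ∃ x ∈ e, x ∈ S) ∪ N.filter (fun e => ¬ ∃ x ∈ e, x ∈ S)

theorem mix_mem {V : Type} (S : Set V) (M N : Finset (Sym2 V)) (e : Sym2 V) :
    e ∈ mix S M N ↔ (e ∈ M ∧ ∃ x ∈ e, x ∈ S) ∨ (e ∈ N ∧ ¬ ∃ x ∈ e, x ∈ S) := by
  simp only [mix, Finset.mem_union, Finset.mem_filter]

theorem mix_card {V : Type} (S : Set V) (M N : Finset (Sym2 V)) :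
    (mix S M N).card + (mix S N M).card = M.card + N.card := by
  classical
  have key : ∀ M N : Finset (Sym2 V), (mix S M N).card =
      (M.filter (fun e => ∃ x ∈ e, x ∈ S)).card +
        (N.filter (fun e => ¬ ∃ x ∈ e, x ∈ S)).card := by
    intro M N
    unfold mix
    apply Finset.card_union_of_disjoint
    rw [Finset.disjoint_left]
    intro e h1 h2
    rw [Finset.mem_filter] at h1 h2
    exact h2.2 h1.2
  rw [key, key]
  have h1 := M.card_filter_add_card_filter_not (fun e => ∃ x ∈ e, x ∈ S)
  have h2 := N.card_filter_add_card_filter_not (fun e => ∃ x ∈ e, x ∈ S)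
  omega

theorem mix_matching {V : Type} (T : SimpleGraph V) (S : Set V) (M N : Finset (Sym2 V))
    (hM : IsMatchingSet T M) (hN : IsMatchingSet T N)
    (hS : ∀ e ∈ M, ∀ x ∈ e, ∀ y ∈ e, x ∈ S → y ∈ S) :
    IsMatchingSet T (mix S M N) := by
  refine ⟨fun e he => ?_, fun e he f hf hef v hve hvf => ?_⟩
  · rw [mix_mem] at he
    rcases he with he | he
    · exact hM.1 e he.1
    · exact hN.1 e he.1
  · rw [mix_mem] at he hf
    rcases he with ⟨he, he'⟩ | ⟨he, he'⟩ <;> rcases hf with ⟨hf, hf'⟩ | ⟨hf, hf'⟩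
    · exact hM.2 e he f hf hef v hve hvf
    · obtain ⟨x, hx, hxS⟩ := he'
      exact hf' ⟨v, hvf, hS e he x hx v hve hxS⟩
    · obtain ⟨x, hx, hxS⟩ := hf'
      exact he' ⟨v, hve, hS f hf x hx v hvf hxS⟩
    · exact hN.2 e he f hf hef v hve hvf

/-- Exchange along a bridge `uv`: two maximum matchings avoiding `uv` can be mixed. -/
theorem exchange {V : Type} [Fintype V] (T : SimpleGraph V) (hT : T.IsTree) {u v : V}
    (huv : T.Adj u v) (M N : Finset (Sym2 V))
    (hM : IsMatchingSet T M) (hN : IsMatchingSet T N)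
    (hMc : M.card = nu T) (hNc : N.card = nu T)
    (hM' : s(u, v) ∉ M) (hN' : s(u, v) ∉ N) :
    ∃ L : Finset (Sym2 V), IsMatchingSet T L ∧ L.card = nu T ∧
      (∀ e, u ∈ e → (e ∈ L ↔ e ∈ M)) ∧ (∀ e ∈ T.edgeSet, e ≠ s(u, v) → v ∈ e → (e ∈ L ↔ e ∈ N)) := by
  have hb : ¬ (T.deleteEdges {s(u, v)}).Reachable u v :=
    isBridge_iff.1 (isAcyclic_iff_forall_adj_isBridge.1 hT.2 huv)
  set S : Set V := {x | (T.deleteEdges {s(u, v)}).Reachable u x} with hSdef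
  have hS : ∀ e ∈ T.edgeSet, e ≠ s(u, v) → ∀ x ∈ e, ∀ y ∈ e, x ∈ S → y ∈ S := by
    intro e he hne x hx y hy hxS
    by_cases hxy : x = y
    · exact hxy ▸ hxS
    · have hexy : e = s(x, y) := (Sym2.mem_and_mem_iff hxy).1 ⟨hx, hy⟩
      subst hexy
      refine Reachable.trans hxS (Adj.reachable ?_)
      rw [deleteEdges_adj]
      exact ⟨he, hne⟩
  have hSM : ∀ e ∈ M, ∀ x ∈ e, ∀ y ∈ e, x ∈ S → y ∈ S := fun e he =>
    hS e (hM.1 e he) (fun h => hM' (h ▸ he))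
  have hSN : ∀ e ∈ N, ∀ x ∈ e, ∀ y ∈ e, x ∈ S → y ∈ S := fun e he =>
    hS e (hN.1 e he) (fun h => hN' (h ▸ he))
  have m1 := mix_matching T S M N hM hN hSM
  have m2 := mix_matching T S N M hN hM hSN
  have c1 := card_le_nu T _ m1
  have c2 := card_le_nu T _ m2
  have c3 := mix_card S M N
  refine ⟨mix S M N, m1, by omega, ?_, ?_⟩
  · intro e he
    have : ∃ x ∈ e, x ∈ S := ⟨u, he, Reachable.refl _⟩
    simp only [mix_mem, this, and_true, not_true_eq_false, not_false_eq_true, and_false, or_false, false_or]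
  · intro e heT hne he
    have : ¬ ∃ x ∈ e, x ∈ S := by
      rintro ⟨x, hx, hxS⟩
      exact hb (hS e heT hne x hx v he hxS)
    simp only [mix_mem, this, and_true, not_true_eq_false, not_false_eq_true, and_false, or_false, false_or]

theorem D_indep {V : Type} [Fintype V] (T : SimpleGraph V) (hT : T.IsTree) {u v : V}
    (huv : T.Adj u v) (hu : u ∈ gallaiD T) (hv : v ∈ gallaiD T) : False := by
  classical
  obtain ⟨M, hM, hMc, hMu⟩ := hu
  obtain ⟨N, hN, hNc, hNv⟩ := hv
  have hM' : s(u, v) ∉ M := fun h => hMu ⟨_, h, Sym2.mem_mk_left u v⟩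
  have hN' : s(u, v) ∉ N := fun h => hNv ⟨_, h, Sym2.mem_mk_right u v⟩
  obtain ⟨L, hL, hLc, hLu, hLv⟩ := exchange T hT huv M N hM hN hMc hNc hM' hN'
  have h1 : ∀ e ∈ L, u ∉ e := fun e he hue => hMu ⟨e, (hLu e hue).1 he, hue⟩
  have h2 : ∀ e ∈ L, v ∉ e := fun e he hve =>
    hNv ⟨e, (hLv e (hL.1 e he) (fun h => h1 e he (h ▸ Sym2.mem_mk_left u v)) hve).1 he, hve⟩
  have hm : IsMatchingSet T (insert s(u, v) L) := by
    refine ⟨?_, ?_⟩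
    · intro e he
      rcases Finset.mem_insert.1 he with rfl | he
      · exact huv
      · exact hL.1 e he
    · intro e he f hf hef x hx hx'
      rw [Finset.mem_insert] at he hf
      rcases he with rfl | he <;> rcases hf with rfl | hf
      · exact hef rfl
      · rcases Sym2.mem_iff.1 hx with rfl | rfl
        · exact h1 f hf hx'
        · exact h2 f hf hx'
      · rcases Sym2.mem_iff.1 hx' with rfl | rfl
        · exact h1 e he hx
        · exact h2 e he hx
      · exact hL.2 e he f hf hef x hx hx'
  have := card_le_nu T _ hm
  rw [Finset.card_insert_of_notMem (fun h => h1 _ h (Sym2.mem_mk_left u v))] at this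
  omega

theorem A_partner {V : Type} [Fintype V] (T : SimpleGraph V) (hT : T.IsTree)
    (M : Finset (Sym2 V)) (hM : IsMatchingSet T M) (hMc : M.card = nu T) {a b : V}
    (ha : a ∈ gallaiA T) (hab : s(a, b) ∈ M) : b ∈ gallaiD T := by
  classical
  obtain ⟨haD, u, hu, hau⟩ := ha
  by_cases hub : u = b
  · exact hub ▸ hu
  obtain ⟨N, hN, hNc, hNu⟩ := hu
  have hN' : s(u, a) ∉ N := fun h => hNu ⟨_, h, Sym2.mem_mk_left u a⟩
  have hM' : s(u, a) ∉ M := by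
    intro h
    refine hM.2 _ hab _ h ?_ a (Sym2.mem_mk_left a b) (Sym2.mem_mk_right u a)
    rw [Sym2.eq_swap, Ne, Sym2.congr_left]
    exact fun h => hub h.symm
  obtain ⟨L, hL, hLc, hLu, hLv⟩ := exchange T hT hau.symm N M hN hM hNc hMc hN' hM'
  have h1 : ∀ e ∈ L, u ∉ e := fun e he hue => hNu ⟨e, (hLu e hue).1 he, hue⟩
  have habL : s(a, b) ∈ L :=
    (hLv _ (hM.1 _ hab) (fun h => hM' (h ▸ hab)) (Sym2.mem_mk_left a b)).2 hab
  have h2 : ∀ e ∈ L.erase s(a, b), a ∉ e ∧ b ∉ e := by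
    intro e he
    rw [Finset.mem_erase] at he
    exact ⟨fun h => hL.2 e he.2 _ habL he.1 a h (Sym2.mem_mk_left a b),
      fun h => hL.2 e he.2 _ habL he.1 b h (Sym2.mem_mk_right a b)⟩
  have hba : b ≠ a := (T.ne_of_adj (hM.1 _ hab)).symm
  refine ⟨insert s(u, a) (L.erase s(a, b)), ⟨?_, ?_⟩, ?_, ?_⟩
  · intro e he
    rcases Finset.mem_insert.1 he with rfl | he
    · exact hau.symm
    · exact hL.1 e (Finset.mem_of_mem_erase he)
  · intro e he f hf hef x hx hx'
    rw [Finset.mem_insert] at he hf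
    rcases he with rfl | he <;> rcases hf with rfl | hf
    · exact hef rfl
    · rcases Sym2.mem_iff.1 hx with rfl | rfl
      · exact h1 f (Finset.mem_of_mem_erase hf) hx'
      · exact (h2 f hf).1 hx'
    · rcases Sym2.mem_iff.1 hx' with rfl | rfl
      · exact h1 e (Finset.mem_of_mem_erase he) hx
      · exact (h2 e he).1 hx
    · exact hL.2 e (Finset.mem_of_mem_erase he) f (Finset.mem_of_mem_erase hf) hef x hx hx'
  · rw [Finset.card_insert_of_notMem
      (fun h => h1 _ (Finset.mem_of_mem_erase h) (Sym2.mem_mk_left u a)),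
      Finset.card_erase_add_one habL, hLc]
  · rintro ⟨e, he, hbe⟩
    rcases Finset.mem_insert.1 he with rfl | he
    · rcases Sym2.mem_iff.1 hbe with h | h
      · exact hub h.symm
      · exact hba h
    · exact (h2 e he).2 hbe

theorem exists_parent {V : Type} (T : SimpleGraph V) (hT : T.IsTree) :
    ∃ p : V → V, ∀ u v, T.Adj u v → p u = v ∨ p v = u := by
  classical
  obtain ⟨r⟩ := hT.1.nonempty
  choose f hf hf' using (hT.existsUnique_path · r)
  refine ⟨fun v => (f v).snd, fun u v huv => ?_⟩
  by_cases h : v ∈ (f u).support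
  · exact Or.inl (hT.2.eq_snd_of_adj_start (hf u) huv h).symm
  · right
    have : (Walk.cons huv.symm (f u)).IsPath := (hf u).cons h
    have := hf' v _ this
    simp only
    rw [← this, Walk.snd_cons]

/-- If `T` is a tree in which every vertex of `A_T` has degree
at most `3`, then `ν(T) ≥ (n(T) - 1)/3`. -/
theorem statement5 {V : Type} [Fintype V] (T : SimpleGraph V) (hT : T.IsTree)
    (hdeg : ∀ v ∈ gallaiA T, (T.neighborSet v).ncard ≤ 3) :
    ((Nat.card V : ℝ) - 1) / 3 ≤ nu T := by
  classical
  obtain ⟨M, hM, hMc⟩ := exists_max T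
  obtain ⟨p, hp⟩ := exists_parent T hT
  have hcov : ∀ v, v ∉ gallaiD T → ∃ e ∈ M, v ∈ e := by
    intro v hv
    by_contra h
    exact hv ⟨M, hM, hMc, h⟩
  set A : Finset V := Finset.univ.filter (· ∈ gallaiA T) with hA
  set C : Finset V := Finset.univ.filter (· ∈ gallaiC T) with hC
  set MA := M.filter (fun e => ∃ x ∈ e, x ∈ gallaiA T) with hMA
  set MC := M.filter (fun e => ¬ ∃ x ∈ e, x ∈ gallaiA T) with hMC
  have hsum : MA.card + MC.card = nu T := by
    rw [← hMc]; exact M.card_filter_add_card_filter_not _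
  have hAc : A.card ≤ MA.card := by
    have hf : ∀ a : V, ∃ e : Sym2 V, a ∈ gallaiA T → e ∈ M ∧ a ∈ e := by
      intro a
      by_cases ha : a ∈ gallaiA T
      · obtain ⟨e, he⟩ := hcov a ha.1
        exact ⟨e, fun _ => he⟩
      · exact ⟨s(a, a), fun h => absurd h ha⟩
    choose f hf using hf
    apply Finset.card_le_card_of_injOn f
    · intro a ha
      have ha : a ∈ gallaiA T := by simpa [hA] using ha
      simp only [hMA, Finset.coe_filter, Set.mem_ofPred_eq]
      exact ⟨(hf a ha).1, a, (hf a ha).2, ha⟩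
    · intro a ha b hb hab
      have ha : a ∈ gallaiA T := by simpa [hA] using ha
      have hb : b ∈ gallaiA T := by simpa [hA] using hb
      by_contra hne
      have h1 := hf a ha
      have h2 := hf b hb
      rw [← hab] at h2
      have he : f a = s(a, b) := (Sym2.mem_and_mem_iff hne).1 ⟨h1.2, h2.2⟩
      exact hb.1 (A_partner T hT M hM hMc ha (he ▸ h1.1))
  have hCc : C.card ≤ MC.card * 2 := by
    have hsub : C ⊆ MC.biUnion Sym2.toFinset := by
      intro c hc
      have hc : c ∈ gallaiC T := by simpa [hC] using hc
      obtain ⟨e, he, hce⟩ := hcov c hc.1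
      rw [Finset.mem_biUnion]
      refine ⟨e, Finset.mem_filter.2 ⟨he, ?_⟩, by simpa using hce⟩
      rintro ⟨x, hx, hxA⟩
      have hne : x ≠ c := by rintro rfl; exact hc.2 hxA
      have he' : e = s(x, c) := (Sym2.mem_and_mem_iff hne).1 ⟨hx, hce⟩
      exact hc.1 (A_partner T hT M hM hMc hxA (he' ▸ he))
    refine (Finset.card_le_card hsub).trans (Finset.card_biUnion_le_card_mul _ _ _ ?_)
    intro e _
    rw [Sym2.card_toFinset]
    split_ifs <;> omega
  have hE : T.edgeFinset ⊆ A.biUnion (fun a => T.incidenceFinset a) ∪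
      C.image (fun c => s(c, p c)) := by
    intro e he
    induction e using Sym2.ind with
    | _ x y =>
    have hxy : T.Adj x y := by simpa using he
    rw [Finset.mem_union, Finset.mem_biUnion, Finset.mem_image]
    by_cases hx : x ∈ gallaiA T
    · left
      exact ⟨x, by simpa [hA] using hx, by simpa [mem_incidenceFinset, mk'_mem_incidenceSet_iff] using hxy⟩
    by_cases hy : y ∈ gallaiA T
    · left
      exact ⟨y, by simpa [hA] using hy, by simpa [mem_incidenceFinset, mk'_mem_incidenceSet_iff] using hxy⟩
    right
    have hxD : x ∉ gallaiD T := fun h => by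
      by_cases hyD : y ∈ gallaiD T
      · exact D_indep T hT hxy h hyD
      · exact hy ⟨hyD, x, h, hxy.symm⟩
    have hyD : y ∉ gallaiD T := fun h => hx ⟨hxD, y, h, hxy⟩
    rcases hp x y hxy with h | h
    · exact ⟨x, Finset.mem_filter.2 ⟨Finset.mem_univ x, hxD, hx⟩, by rw [h]⟩
    · exact ⟨y, Finset.mem_filter.2 ⟨Finset.mem_univ y, hyD, hy⟩, by rw [h, Sym2.eq_swap]⟩
  have hEc : T.edgeFinset.card ≤ A.card * 3 + C.card := by
    refine (Finset.card_le_card hE).trans ((Finset.card_union_le _ _).trans ?_)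
    refine add_le_add (Finset.card_biUnion_le_card_mul _ _ _ ?_) Finset.card_image_le
    intro a ha
    have ha : a ∈ gallaiA T := by simpa [hA] using ha
    have := hdeg a ha
    rw [card_incidenceFinset_eq_degree, ← card_neighborFinset_eq_degree]
    rwa [Set.ncard_eq_toFinset_card'] at this
  have hn := hT.card_edgeFinset
  rw [← Nat.card_eq_fintype_card] at hn
  have hfin : Nat.card V ≤ 3 * nu T + 1 := by omega
  have : (Nat.card V : ℝ) ≤ 3 * nu T + 1 := by exact_mod_cast hfin
  linarith

end URPaper
end

section
/- If T is a tree in 𝒯 and X ⊆ D_T with |X| = 4 such that no vertex in V(T) \ X has 3 neighbors in X, and no vertex w in V(T) \ X has two neighbors u and v in V(T) \ X with X ⊆ N_T(u) ∪ N_T(v), then ν(T − X) = ν(T), where T − X is the subgraph of T induced on V(T) \ X. -/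
open SimpleGraph

namespace URPaper

/-- Rooted rank function. -/
def IsRank {V : Type} (T : SimpleGraph V) (d : V → ℕ) : Prop :=
  (∀ a b, T.Adj a b → d a ≠ d b) ∧
  ∀ v a b, T.Adj v a → T.Adj v b → d a < d v → d b < d v → a = b

lemma exists_rank {V : Type} (T : SimpleGraph V) (hT : T.IsTree) : ∃ d, IsRank T d := by
  classical
  obtain ⟨r⟩ := hT.connected.nonempty
  refine ⟨fun v => T.dist r v, fun a b h => hT.dist_ne_of_adj r h, ?_⟩
  intro v a b ha hb hda hdb
  have key : ∀ c, T.Adj v c → T.dist r c < T.dist r v →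
      ∃ q : T.Walk r v, q.IsPath ∧ q.penultimate = c := by
    intro c hc hd
    obtain ⟨p, hp, hl⟩ := hT.connected.exists_path_of_dist r c
    refine ⟨p.concat hc.symm, ?_, by simp⟩
    refine hp.concat ?_ hc.symm
    intro hv
    have h1 := SimpleGraph.dist_le (p.takeUntil v hv)
    have h2 := p.length_takeUntil_le_length hv
    omega
  obtain ⟨q1, h1, e1⟩ := key a ha hda
  obtain ⟨q2, h2, e2⟩ := key b hb hdb
  have := (hT.existsUnique_path r v).unique h1 h2
  rw [← e1, ← e2, this]

lemma edge_count {V : Type} [Fintype V] (T : SimpleGraph V) {d : V → ℕ} (hd : IsRank T d)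
    (E : Finset (Sym2 V)) (W : Finset V) (hE : ∀ e ∈ E, e ∈ T.edgeSet)
    (hW : ∀ e ∈ E, ∀ v ∈ e, v ∈ W) (hne : W.Nonempty) : E.card + 1 ≤ W.card := by
  classical
  have key : ∀ e ∈ E, ∃ c p, e = s(c, p) ∧ d p < d c := by
    intro e he
    have h1 := hE e he
    induction e with
    | _ a b =>
      have h2 : T.Adj a b := h1
      rcases lt_or_gt_of_ne (hd.1 a b h2) with h | h
      · exact ⟨b, a, Sym2.eq_swap, h⟩
      · exact ⟨a, b, rfl, h⟩
  have : Nonempty V := ⟨hne.choose⟩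
  choose! c p hc hlt using key
  obtain ⟨r, hr, hmin⟩ := W.exists_min_image d hne
  have h3 : E.card ≤ (W.erase r).card := by
    apply Finset.card_le_card_of_injOn c
    · intro e he
      have he' : e ∈ E := he
      have hp : p e ∈ W := hW e he' _ ⟨c e, (hc e he').trans Sym2.eq_swap⟩
      have hcc : c e ∈ W := hW e he' _ ⟨p e, hc e he'⟩
      refine Finset.mem_coe.2 (Finset.mem_erase.2 ⟨?_, hcc⟩)
      intro h
      have := hmin _ hp
      have := hlt e he'
      rw [h] at this
      omega
    · intro e he f hf hef
      have he' : e ∈ E := he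
      have hf' : f ∈ E := hf
      have a1 : T.Adj (c e) (p e) := by
        have := hE e he'
        rw [hc e he'] at this
        exact this
      have a2 : T.Adj (c f) (p f) := by
        have := hE f hf'
        rw [hc f hf'] at this
        exact this
      rw [← hef] at a2
      have := hd.2 (c e) (p e) (p f) a1 a2 (hlt e he') (by rw [hef]; exact hlt f hf')
      rw [hc e he', hc f hf', this, hef]
  rw [Finset.card_erase_of_mem hr] at h3
  have := Finset.card_pos.2 hne
  omega

lemma konig {V : Type} [Fintype V] (T : SimpleGraph V) {d : V → ℕ} (hd : IsRank T d) (n : ℕ) :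
    ∀ H : SimpleGraph V, H ≤ T → H.edgeSet.ncard ≤ n →
    ∃ (M : Finset (Sym2 V)) (K : Finset V), IsMatchingSet H M ∧
      (∀ a b, H.Adj a b → a ∈ K ∨ b ∈ K) ∧ K.card ≤ M.card := by
  classical
  induction n with
  | zero =>
    intro H hH hn
    have : H.edgeSet = ∅ := by
      rw [← Set.ncard_eq_zero]; omega
    refine ⟨∅, ∅, by simp [IsMatchingSet], ?_, le_rfl⟩
    intro a b hab
    have : s(a, b) ∈ H.edgeSet := hab
    simp_all
  | succ n ih =>
    intro H hH hn
    by_cases hemp : ∃ a b, H.Adj a b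
    · obtain ⟨a, b, hab⟩ := hemp
      obtain ⟨u, hu, hmax⟩ := (Finset.univ.filter fun u => ∃ v, H.Adj u v).exists_max_image d
        ⟨a, by simp; exact ⟨b, hab⟩⟩
      simp only [Finset.mem_filter, Finset.mem_univ, true_and] at hu hmax
      obtain ⟨v, huv⟩ := hu
      have hlt : ∀ w, H.Adj u w → d w < d u := fun w hw =>
        lt_of_le_of_ne (hmax w ⟨u, hw.symm⟩) (hd.1 _ _ (hH hw.symm))
      have huniq : ∀ w, H.Adj u w → w = v := fun w hw =>
        hd.2 u w v (hH hw) (hH huv) (hlt w hw) (hlt v huv)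
      obtain ⟨M, K, hM, hK, hc⟩ := ih (H.deleteIncidenceSet v)
        ((H.deleteIncidenceSet_le v).trans hH) (by
          have : (H.deleteIncidenceSet v).edgeSet ⊂ H.edgeSet := by
            refine ⟨?_, ?_⟩
            · exact edgeSet_mono (H.deleteIncidenceSet_le v)
            · intro h
              have h2 : s(u, v) ∈ (H.deleteIncidenceSet v).edgeSet := h huv
              rw [mem_edgeSet, deleteIncidenceSet_adj] at h2
              exact h2.2.2 rfl
          have := Set.ncard_lt_ncard this
          omega)
      have hMv : ∀ e ∈ M, v ∉ e ∧ u ∉ e := by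
        intro e he
        have h1 := hM.1 e he
        induction e with
        | _ x y =>
          rw [mem_edgeSet, deleteIncidenceSet_adj] at h1
          obtain ⟨h1, h2, h3⟩ := h1
          simp only [Sym2.mem_iff, not_or]
          refine ⟨⟨h2.symm, h3.symm⟩, ?_, ?_⟩
          · rintro rfl; exact h3 (huniq _ h1)
          · rintro rfl; exact h2 (huniq _ h1.symm)
      refine ⟨insert s(u, v) M, insert v K, ⟨?_, ?_⟩, ?_, ?_⟩
      · intro e he
        rcases Finset.mem_insert.1 he with rfl | he
        · exact huv
        · exact edgeSet_mono (H.deleteIncidenceSet_le v) (hM.1 e he)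
      · intro e he f hf hne x hx hx'
        rcases Finset.mem_insert.1 he with rfl | he
        · rcases Finset.mem_insert.1 hf with rfl | hf
          · exact hne rfl
          · have := hMv f hf
            rcases Sym2.mem_iff.1 hx with rfl | rfl <;> tauto
        · rcases Finset.mem_insert.1 hf with rfl | hf
          · have := hMv e he
            rcases Sym2.mem_iff.1 hx' with rfl | rfl <;> tauto
          · exact hM.2 e he f hf hne x hx hx'
      · intro x y hxy
        by_cases hx : x = v
        · simp [hx]
        by_cases hy : y = v
        · simp [hy]
        have := hK x y (by rw [deleteIncidenceSet_adj]; exact ⟨hxy, hx, hy⟩)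
        simp; tauto
      · rw [Finset.card_insert_of_notMem (fun h => (hMv _ h).1 (by simp))]
        exact (Finset.card_insert_le _ _).trans (by omega)
    · refine ⟨∅, ∅, by simp [IsMatchingSet], ?_, le_rfl⟩
      intro a b hab
      exact absurd ⟨a, b, hab⟩ hemp

lemma match_le {V : Type} {G : SimpleGraph V} {M : Finset (Sym2 V)} (hM : IsMatchingSet G M)
    (K : Finset V) (h : ∀ e ∈ M, ∃ v ∈ K, v ∈ e) : M.card ≤ K.card := by
  classical
  by_cases hne : Nonempty V
  · choose! g hg hg' using h
    apply Finset.card_le_card_of_injOn g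
    · intro e he
      exact hg e he
    · intro e he f hf hef
      by_contra hne
      exact hM.2 e he f hf hne (g e) (hg' e he) (by rw [hef]; exact hg' f hf)
  · have : M = ∅ := by
      rw [Finset.eq_empty_iff_forall_notMem]
      intro e he
      exact hne ⟨(h e he).choose⟩
    simp [this]

lemma nu_bdd {V : Type} [Finite V] (G : SimpleGraph V) :
    BddAbove {k | ∃ M : Finset (Sym2 V), IsMatchingSet G M ∧ M.card = k} := by
  classical
  have := Fintype.ofFinite V
  refine ⟨Fintype.card (Sym2 V), ?_⟩
  rintro k ⟨M, -, rfl⟩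
  exact M.card_le_univ

lemma le_nu {V : Type} [Finite V] {G : SimpleGraph V} {M : Finset (Sym2 V)}
    (hM : IsMatchingSet G M) : M.card ≤ nu G :=
  le_csSup (nu_bdd G) ⟨M, hM, rfl⟩

lemma exists_nu {V : Type} [Finite V] (G : SimpleGraph V) :
    ∃ M : Finset (Sym2 V), IsMatchingSet G M ∧ M.card = nu G :=
  Nat.sSup_mem (s := {k | ∃ M : Finset (Sym2 V), IsMatchingSet G M ∧ M.card = k})
    ⟨0, ∅, by simp [IsMatchingSet], rfl⟩ (nu_bdd G)

/-- Minimum vertex cover. -/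
def IsMinCover {V : Type} (G : SimpleGraph V) (K : Finset V) : Prop :=
  (∀ a b, G.Adj a b → a ∈ K ∨ b ∈ K) ∧ K.card ≤ nu G

lemma cover_edge {V : Type} {G : SimpleGraph V} {K : Finset V}
    (hK : ∀ a b, G.Adj a b → a ∈ K ∨ b ∈ K) {e : Sym2 V} (he : e ∈ G.edgeSet) :
    ∃ v ∈ K, v ∈ e := by
  induction e with
  | _ a b =>
    rcases hK a b he with h | h
    · exact ⟨a, h, by simp⟩
    · exact ⟨b, h, by simp⟩

lemma exists_cover {V : Type} [Fintype V] (T : SimpleGraph V) {d : V → ℕ} (hd : IsRank T d) :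
    ∃ K, IsMinCover T K := by
  obtain ⟨M, K, hM, hK, hc⟩ := konig T hd _ T le_rfl le_rfl
  exact ⟨K, hK, hc.trans (le_nu hM)⟩

lemma exists_cover_mem {V : Type} [Fintype V] (T : SimpleGraph V) {d : V → ℕ} (hd : IsRank T d)
    (v : V) (hv : v ∉ gallaiD T) : ∃ K, IsMinCover T K ∧ v ∈ K := by
  classical
  obtain ⟨M, K, hM, hK, hc⟩ := konig T hd _ (T.deleteIncidenceSet v)
    (T.deleteIncidenceSet_le v) le_rfl
  have hMT : IsMatchingSet T M :=
    ⟨fun e he => edgeSet_mono (T.deleteIncidenceSet_le v) (hM.1 e he), hM.2⟩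
  have h1 := le_nu hMT
  have h2 : M.card ≠ nu T := by
    intro h
    apply hv
    refine ⟨M, hMT, h, ?_⟩
    rintro ⟨e, he, hve⟩
    have h1 := hM.1 e he
    induction e with
    | _ x y =>
      rw [mem_edgeSet, deleteIncidenceSet_adj] at h1
      rcases Sym2.mem_iff.1 hve with h | h
      · exact h1.2.1 h.symm
      · exact h1.2.2 h.symm
  refine ⟨insert v K, ⟨?_, (Finset.card_insert_le _ _).trans (by omega)⟩, by simp⟩
  intro x y hxy
  by_cases hx : x = v
  · simp [hx]
  by_cases hy : y = v
  · simp [hy]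
  have := hK x y (by rw [deleteIncidenceSet_adj]; exact ⟨hxy, hx, hy⟩)
  simp; tauto

lemma D_notMem {V : Type} [Fintype V] {T : SimpleGraph V} {K : Finset V} (hK : IsMinCover T K)
    {v : V} (hv : v ∈ gallaiD T) : v ∉ K := by
  classical
  intro hvK
  obtain ⟨M, hM, hc, hvM⟩ := hv
  have := match_le hM (K.erase v) (by
    intro e he
    obtain ⟨w, hw, hwe⟩ := cover_edge hK.1 (hM.1 e he)
    refine ⟨w, Finset.mem_erase.2 ⟨?_, hw⟩, hwe⟩
    rintro rfl
    exact hvM ⟨e, he, hwe⟩)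
  rw [Finset.card_erase_of_mem hvK] at this
  have := hK.2
  have := Finset.card_pos.2 ⟨v, hvK⟩
  omega

lemma A_mem {V : Type} [Fintype V] {T : SimpleGraph V} {K : Finset V} (hK : IsMinCover T K)
    {v : V} (hv : v ∈ gallaiA T) : v ∈ K := by
  obtain ⟨-, u, hu, huv⟩ := hv
  exact (hK.1 v u huv).resolve_right (D_notMem hK hu)

lemma A_match {V : Type} [Fintype V] {T : SimpleGraph V} {d : V → ℕ} (hd : IsRank T d)
    {M : Finset (Sym2 V)} (hM : IsMatchingSet T M) (hc : M.card = nu T) {a c : V}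
    (ha : a ∈ gallaiA T) (hac : s(a, c) ∈ M) : c ∈ gallaiD T := by
  classical
  by_contra hcD
  obtain ⟨K, hK, hcK⟩ := exists_cover_mem T hd c hcD
  have haK := A_mem hK ha
  have hne : a ≠ c := (hM.1 _ hac : T.Adj a c).ne
  have := match_le hM (K.erase c) (by
    intro e he
    by_cases heq : e = s(a, c)
    · exact ⟨a, Finset.mem_erase.2 ⟨hne, haK⟩, by simp [heq]⟩
    obtain ⟨w, hw, hwe⟩ := cover_edge hK.1 (hM.1 e he)
    refine ⟨w, Finset.mem_erase.2 ⟨?_, hw⟩, hwe⟩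
    rintro rfl
    exact hM.2 e he _ hac heq w hwe (by simp))
  rw [Finset.card_erase_of_mem hcK] at this
  have := hK.2
  have := Finset.card_pos.2 ⟨c, hcK⟩
  omega

lemma D_indep_s9 {V : Type} [Fintype V] {T : SimpleGraph V} {d : V → ℕ} (hd : IsRank T d)
    {a b : V} (ha : a ∈ gallaiD T) (hb : b ∈ gallaiD T) : ¬ T.Adj a b := by
  intro h
  obtain ⟨K, hK⟩ := exists_cover T hd
  exact (hK.1 a b h).elim (D_notMem hK ha) (D_notMem hK hb)

lemma card_covered {V : Type} [DecidableEq V] {M : Finset (Sym2 V)}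
    (W : Finset V) (hW : ∀ w ∈ W, w ∈ covered M) :
    W.card ≤ 2 * M.card := by
  have h1 : W ⊆ M.biUnion (fun e => e.toFinset) := by
    intro w hw
    obtain ⟨e, he, hwe⟩ := hW w hw
    exact Finset.mem_biUnion.2 ⟨e, he, by simpa using hwe⟩
  refine (Finset.card_le_card h1).trans (Finset.card_biUnion_le.trans ?_)
  calc ∑ e ∈ M, e.toFinset.card ≤ ∑ e ∈ M, 2 := Finset.sum_le_sum (by
        intro e _
        induction e with
        | _ a b => 
          rw [Sym2.toFinset_mk_eq]; exact Finset.card_le_two)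
    _ = 2 * M.card := by simp [mul_comm]

lemma struct_T {V : Type} [Fintype V] [DecidableEq V] (T : SimpleGraph V) [DecidableRel T.Adj]
    (hT : MemT T)
    {d : V → ℕ} (hd : IsRank T d) : ∃ A : Finset V, (∀ v, v ∈ A ↔ v ∉ gallaiD T) ∧
      A.card = nu T ∧ (∀ a ∈ A, (T.neighborFinset a).card = 3) ∧
      ∀ a ∈ A, ∀ b ∈ A, ¬ T.Adj a b := by
  classical
  obtain ⟨htree, hdeg, hn⟩ := hT
  have hE : T.edgeFinset.card = 3 * nu T := by
    have := htree.card_edgeFinset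
    rw [Nat.card_eq_fintype_card] at hn
    omega
  let A : Finset V := Finset.univ.filter (· ∈ gallaiA T)
  let C : Finset V := Finset.univ.filter (· ∈ gallaiC T)
  have mA : ∀ v, v ∈ A ↔ v ∈ gallaiA T := by simp [A]
  have mC : ∀ v, v ∈ C ↔ v ∈ gallaiC T := by simp [C]
  have hdegA : ∀ a ∈ A, (T.incidenceFinset a).card ≤ 3 := by
    intro a ha
    rw [card_incidenceFinset_eq_degree, ← card_neighborSet_eq_degree, ← Nat.card_eq_fintype_card]
    exact hdeg a ((mA a).1 ha)
  let EC := T.edgeFinset.filter (fun e => ∀ v ∈ e, v ∈ C)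
  have hsub : T.edgeFinset ⊆ A.biUnion (fun a => T.incidenceFinset a) ∪ EC := by
    intro e he
    induction e with
    | _ a b =>
      have hab : T.Adj a b := by simpa using he
      by_cases ha : a ∈ A
      · refine Finset.mem_union_left _ (Finset.mem_biUnion.2 ⟨a, ha, ?_⟩)
        simp [mem_incidenceFinset, incidenceSet, hab]
      by_cases hb : b ∈ A
      · refine Finset.mem_union_left _ (Finset.mem_biUnion.2 ⟨b, hb, ?_⟩)
        simp [mem_incidenceFinset, incidenceSet, hab]
      refine Finset.mem_union_right _ (Finset.mem_filter.2 ⟨he, ?_⟩)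
      rw [mA] at ha hb
      have haD : a ∉ gallaiD T := by
        intro h
        by_cases h' : b ∈ gallaiD T
        · exact D_indep_s9 hd h h' hab
        · exact hb ⟨h', a, h, hab.symm⟩
      have hbD : b ∉ gallaiD T := fun h => ha ⟨haD, b, h, hab⟩
      intro v hv
      rw [mC]
      rcases Sym2.mem_iff.1 hv with rfl | rfl
      · exact ⟨haD, ha⟩
      · exact ⟨hbD, hb⟩
  have hA1 : (A.biUnion (fun a => T.incidenceFinset a)).card ≤ 3 * A.card := by
    rw [mul_comm]
    exact Finset.card_biUnion_le_card_mul _ _ _ hdegA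
  have hle : 3 * nu T ≤ 3 * A.card + EC.card := by
    rw [← hE]
    exact (Finset.card_le_card hsub).trans ((Finset.card_union_le _ _).trans (by omega))
  obtain ⟨M, hM, hMc⟩ := exists_nu T
  have hcov : ∀ v, v ∉ gallaiD T → v ∈ covered M := by
    intro v hv
    by_contra h
    exact hv ⟨M, hM, hMc, h⟩
  have hg : ∀ a ∈ A, ∃ c, s(a, c) ∈ M := by
    intro a ha
    obtain ⟨e, he, hae⟩ := hcov a ((mA a).1 ha).1
    obtain ⟨c, rfl⟩ := hae
    exact ⟨c, he⟩
  have : Nonempty V := htree.connected.nonempty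
  choose! g hg using hg
  have hgD : ∀ a ∈ A, g a ∈ gallaiD T := fun a ha => A_match hd hM hMc ((mA a).1 ha) (hg a ha)
  have hinj : Set.InjOn g A := by
    intro a ha b hb hab
    by_contra hne
    refine hM.2 _ (hg a ha) _ (hg b hb) ?_ (g a) (by simp) (by simp [hab])
    rw [hab]
    intro h
    rw [Sym2.eq_iff] at h
    rcases h with h | h
    · exact hne h.1
    · have := (hM.1 _ (hg b hb) : T.Adj _ _).ne
      exact this h.2.symm
  have hd1 : Disjoint A C := by
    rw [Finset.disjoint_left]
    intro v hv hv'
    exact ((mC v).1 hv').2 ((mA v).1 hv)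
  have hd2 : Disjoint (A ∪ C) (A.image g) := by
    rw [Finset.disjoint_left]
    intro v hv hv'
    obtain ⟨a, ha, rfl⟩ := Finset.mem_image.1 hv'
    rcases Finset.mem_union.1 hv with h | h
    · exact ((mA _).1 h).1 (hgD a ha)
    · exact ((mC _).1 h).1 (hgD a ha)
  have hcard : 2 * A.card + C.card ≤ 2 * nu T := by
    have := card_covered (M := M) ((A ∪ C) ∪ A.image g) (by
      intro w hw
      rcases Finset.mem_union.1 hw with hw | hw
      · rcases Finset.mem_union.1 hw with h | h
        · exact hcov _ ((mA _).1 h).1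
        · exact hcov _ ((mC _).1 h).1
      · obtain ⟨a, ha, rfl⟩ := Finset.mem_image.1 hw
        exact ⟨_, hg a ha, by simp⟩)
    rw [Finset.card_union_of_disjoint hd2, Finset.card_union_of_disjoint hd1,
      Finset.card_image_of_injOn hinj, hMc] at this
    omega
  have hC : C = ∅ := by
    by_contra hne
    have := edge_count T hd EC C (fun e he => by simpa using (Finset.mem_filter.1 he).1)
      (fun e he => (Finset.mem_filter.1 he).2) (Finset.nonempty_iff_ne_empty.2 hne)
    omega
  have hEC : EC = ∅ := by
    rw [Finset.eq_empty_iff_forall_notMem]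
    intro e he
    have := (Finset.mem_filter.1 he).2
    induction e with
    | _ a b =>
      have := this a (by simp)
      rw [hC] at this
      simp at this
  rw [hEC] at hle hsub
  rw [Finset.union_empty] at hsub
  simp only [Finset.card_empty] at hle
  have hAc : A.card = nu T := by omega
  refine ⟨A, ?_, hAc, ?_, ?_⟩
  · intro v
    refine ⟨fun h => ((mA v).1 h).1, fun h => ?_⟩
    by_contra h'
    have : v ∈ C := (mC v).2 ⟨h, fun h'' => h' ((mA v).2 h'')⟩
    rw [hC] at this
    simp at this
  · intro a ha
    rw [card_neighborFinset_eq_degree, ← card_incidenceFinset_eq_degree]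
    by_contra hne
    have h1 := (Finset.card_le_card hsub).trans Finset.card_biUnion_le
    have h2 : ∑ a ∈ A, (T.incidenceFinset a).card < ∑ a ∈ A, 3 :=
      Finset.sum_lt_sum hdegA ⟨a, ha, lt_of_le_of_ne (hdegA a ha) hne⟩
    simp at h2
    rw [hE] at h1
    simp at h1
    omega
  · intro a ha b hb hab
    have h1 : T.edgeFinset ⊆ (A.erase a).biUnion (fun a => T.incidenceFinset a) ∪
        (T.incidenceFinset a).erase s(a, b) := by
      intro e he
      by_cases heq : e = s(a, b)
      · refine Finset.mem_union_left _ (Finset.mem_biUnion.2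
          ⟨b, Finset.mem_erase.2 ⟨hab.ne', hb⟩, ?_⟩)
        simp [heq, mem_incidenceFinset, incidenceSet, hab]
      obtain ⟨x, hx, hxe⟩ := Finset.mem_biUnion.1 (hsub he)
      by_cases hxa : x = a
      · subst hxa
        exact Finset.mem_union_right _ (Finset.mem_erase.2 ⟨heq, hxe⟩)
      · exact Finset.mem_union_left _ (Finset.mem_biUnion.2
          ⟨x, Finset.mem_erase.2 ⟨hxa, hx⟩, hxe⟩)
    have h2 := (Finset.card_le_card h1).trans (Finset.card_union_le _ _)
    have h3 := Finset.card_biUnion_le_card_mul (A.erase a) (fun a => T.incidenceFinset a) 3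
      (fun x hx => hdegA x (Finset.mem_of_mem_erase hx))
    have h4 : s(a, b) ∈ T.incidenceFinset a := by
      simp [mem_incidenceFinset, incidenceSet, hab]
    have h5 := Finset.card_erase_lt_of_mem h4
    have h6 := hdegA a ha
    have h7 := Finset.card_erase_lt_of_mem ha
    rw [hE] at h2
    omega

lemma nbr_count {V : Type} [Fintype V] [DecidableEq V] (T : SimpleGraph V) [DecidableRel T.Adj]
    {d : V → ℕ} (hd : IsRank T d) (A S : Finset V) (hS : S ⊆ A) (hne : S.Nonempty)
    (h3 : ∀ a ∈ A, (T.neighborFinset a).card = 3) (hind : ∀ a ∈ A, ∀ b ∈ A, ¬ T.Adj a b) :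
    2 * S.card + 1 ≤ (S.biUnion fun a => T.neighborFinset a).card := by
  have hdis : ∀ x ∈ S, ∀ y ∈ S, x ≠ y →
      Disjoint (T.incidenceFinset x) (T.incidenceFinset y) := by
    intro x hx y hy hxy
    rw [Finset.disjoint_left]
    intro e he he'
    simp only [mem_incidenceFinset, incidenceSet, Set.mem_ofPred_eq] at he he'
    have := (Sym2.mem_and_mem_iff hxy).1 ⟨he.2, he'.2⟩
    rw [this] at he
    exact hind x (hS hx) y (hS hy) he.1
  have h1 := edge_count T hd (S.biUnion fun a => T.incidenceFinset a)
    (S ∪ S.biUnion fun a => T.neighborFinset a) (by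
      intro e he
      obtain ⟨a, ha, hae⟩ := Finset.mem_biUnion.1 he
      simp only [mem_incidenceFinset, incidenceSet, Set.mem_ofPred_eq] at hae
      exact hae.1) (by
      intro e he v hv
      obtain ⟨a, ha, hae⟩ := Finset.mem_biUnion.1 he
      simp only [mem_incidenceFinset, incidenceSet, Set.mem_ofPred_eq] at hae
      by_cases hva : v = a
      · rw [hva]; exact Finset.mem_union_left _ ha
      · have := (Sym2.mem_and_mem_iff hva).1 ⟨hv, hae.2⟩
        rw [this] at hae
        refine Finset.mem_union_right _ (Finset.mem_biUnion.2 ⟨a, ha, ?_⟩)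
        simpa using (hae.1 : T.Adj v a).symm) (hne.mono Finset.subset_union_left)
  rw [Finset.card_biUnion hdis, Finset.sum_congr rfl (g := fun _ => 3) (by
    intro a ha
    rw [card_incidenceFinset_eq_degree, ← card_neighborFinset_eq_degree, h3 a (hS ha)])] at h1
  have := Finset.card_union_le S (S.biUnion fun a => T.neighborFinset a)
  simp at h1
  omega

lemma nu_induce_le {V : Type} [Fintype V] (T : SimpleGraph V) (S : Set V) :
    nu (T.induce S) ≤ nu T := by
  classical
  obtain ⟨M, hM, hc⟩ := exists_nu (T.induce S)
  rw [← hc, ← Finset.card_image_of_injective M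
    (Sym2.map.injective (Subtype.val_injective (p := (· ∈ S))))]
  apply le_nu
  constructor
  · intro e he
    obtain ⟨e', he', rfl⟩ := Finset.mem_image.1 he
    have := hM.1 e' he'
    induction e' with
    | _ a b => exact this
  · intro e he f hf hne v hv hv'
    obtain ⟨e', he', rfl⟩ := Finset.mem_image.1 he
    obtain ⟨f', hf', rfl⟩ := Finset.mem_image.1 hf
    obtain ⟨x, hx, rfl⟩ := Sym2.mem_map.1 hv
    obtain ⟨y, hy, hxy⟩ := Sym2.mem_map.1 hv'
    have := Subtype.val_injective hxy
    subst this
    exact hM.2 e' he' f' hf' (fun h => hne (by rw [h])) _ hx hy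

lemma hall_cond {V : Type} [Fintype V] [DecidableEq V] (T : SimpleGraph V) [DecidableRel T.Adj]
    {d : V → ℕ} (hd : IsRank T d) (A X : Finset V)
    (h3 : ∀ a ∈ A, (T.neighborFinset a).card = 3) (hind : ∀ a ∈ A, ∀ b ∈ A, ¬ T.Adj a b)
    (hAX : Disjoint A X) (hcard : X.card = 4)
    (hno3 : ∀ v ∉ X, (T.neighborFinset v ∩ X).card < 3)
    (hnoW : ∀ w ∉ X, ∀ u ∉ X, ∀ v ∉ X, u ≠ v → T.Adj w u → T.Adj w v →
      ¬ X ⊆ T.neighborFinset u ∪ T.neighborFinset v)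
    (S : Finset V) (hS : S ⊆ A) :
    S.card ≤ ((S.biUnion fun a => T.neighborFinset a) \ X).card := by
  rcases S.eq_empty_or_nonempty with rfl | hne
  · simp
  have h1 := nbr_count T hd A S hS hne h3 hind
  have hnX : ∀ a ∈ S, a ∉ X := fun a ha => Finset.disjoint_left.1 hAX (hS ha)
  set N := S.biUnion fun a => T.neighborFinset a with hN
  have h2 := Finset.card_sdiff_add_card_inter N X
  have h4 : (N ∩ X).card ≤ X.card := Finset.card_le_card Finset.inter_subset_right
  by_contra hlt
  have hpos := Finset.card_pos.2 hne
  have h5 : S.card = 1 ∨ S.card = 2 := by omega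
  rcases h5 with h5 | h5
  · obtain ⟨a, rfl⟩ := Finset.card_eq_one.1 h5
    rw [Finset.singleton_biUnion] at hN
    have := hno3 a (hnX a (by simp))
    rw [← hN] at this
    omega
  · have hXN : X ⊆ N := by
      have : N ∩ X = X := Finset.eq_of_subset_of_card_le Finset.inter_subset_right (by omega)
      rw [← this]; exact Finset.inter_subset_left
    have hNc : N.card = 5 := by omega
    obtain ⟨u, v, huv, rfl⟩ := Finset.card_eq_two.1 h5
    have hNe : N = T.neighborFinset u ∪ T.neighborFinset v := by
      rw [hN]; simp
    have hu := hnX u (by simp)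
    have hv := hnX v (by simp)
    have h6 := Finset.card_union_add_card_inter (T.neighborFinset u) (T.neighborFinset v)
    rw [← hNe, hNc, h3 u (hS (by simp)), h3 v (hS (by simp))] at h6
    obtain ⟨w, hw⟩ := Finset.card_pos.1
      (show 0 < (T.neighborFinset u ∩ T.neighborFinset v).card by omega)
    have hw' := Finset.mem_inter.1 hw
    by_cases hwX : w ∈ X
    · have h7 := Finset.card_union_add_card_inter (T.neighborFinset u ∩ X)
        (T.neighborFinset v ∩ X)
      rw [← Finset.union_inter_distrib_right, ← hNe, Finset.inter_eq_right.2 hXN] at h7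
      have h8 : 0 < ((T.neighborFinset u ∩ X) ∩ (T.neighborFinset v ∩ X)).card :=
        Finset.card_pos.2 ⟨w, by simp_all⟩
      have := hno3 u hu
      have := hno3 v hv
      omega
    · refine hnoW w hwX u hu v hv huv ?_ ?_ (hNe ▸ hXN)
      · simpa using (T.mem_neighborFinset _ _).1 hw'.1 |>.symm
      · simpa using (T.mem_neighborFinset _ _).1 hw'.2 |>.symm

/-- Lemma 4 (iii) of the paper. If `T ∈ 𝒯` and `X ⊆ D_T` with
`|X| = 4` such that no vertex in `V(T) \ X` has `3` neighbors in `X`, and no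
vertex `w ∈ V(T) \ X` has two neighbors `u, v ∈ V(T) \ X` with
`X ⊆ N_T(u) ∪ N_T(v)`, then `ν(T - X) = ν(T)`. -/
theorem statement9 {V : Type} [Fintype V] (T : SimpleGraph V) (hT : MemT T)
    (X : Set V) (hXD : X ⊆ gallaiD T) (hcard : X.ncard = 4)
    (hno3 : ∀ v ∉ X, (T.neighborSet v ∩ X).ncard < 3)
    (hnoW : ∀ w ∉ X, ∀ u ∉ X, ∀ v ∉ X, u ≠ v → T.Adj w u → T.Adj w v →
      ¬ X ⊆ T.neighborSet u ∪ T.neighborSet v) :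
    nu (T.induce Xᶜ) = nu T := by
  classical
  obtain ⟨d, hd⟩ := exists_rank T hT.1
  obtain ⟨A, hA, hAc, h3, hind⟩ := struct_T T hT hd
  refine le_antisymm (nu_induce_le T _) ?_
  have hAX : Disjoint A X.toFinset := by
    rw [Finset.disjoint_left]
    intro a ha hx
    exact (hA a).1 ha (hXD (by simpa using hx))
  have hall := hall_cond T hd A X.toFinset h3 hind hAX
    (by rw [← hcard, Set.ncard_eq_toFinset_card'])
    (by
      intro v hv
      have := hno3 v (by simpa using hv)
      rw [Set.ncard_eq_toFinset_card', Set.toFinset_inter] at this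
      exact this)
    (by
      intro w hw u hu v hv huv h1 h2 hs
      refine hnoW w (by simpa using hw) u (by simpa using hu) v (by simpa using hv) huv h1 h2 ?_
      intro x hx
      have := hs (Set.mem_toFinset.2 hx)
      simpa using this)
  obtain ⟨f, hf, hf'⟩ := (Finset.all_card_le_biUnion_card_iff_exists_injective
    (fun a : A => T.neighborFinset a \ X.toFinset)).1 (by
      intro S
      have h1 := hall (S.map (Function.Embedding.subtype _)) (by
        intro x hx
        obtain ⟨y, -, rfl⟩ := Finset.mem_map.1 hx
        exact y.2)
      rw [Finset.card_map] at h1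
      refine h1.trans (Finset.card_le_card ?_)
      intro x hx
      simp only [Finset.mem_sdiff, Finset.mem_biUnion, Finset.mem_map] at hx ⊢
      obtain ⟨⟨a, ⟨b, hb, rfl⟩, h2⟩, h3⟩ := hx
      exact ⟨b, hb, h2, h3⟩)
  have hadj : ∀ a : A, T.Adj a (f a) := fun a => by
    have := (Finset.mem_sdiff.1 (hf' a)).1
    simpa using this
  have hfX : ∀ a : A, f a ∈ Xᶜ := fun a => by
    have := (Finset.mem_sdiff.1 (hf' a)).2
    simpa using this
  have haX : ∀ a : A, (a : V) ∈ Xᶜ := fun a hx => (hA a).1 a.2 (hXD hx)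
  have hfA : ∀ a b : A, (a : V) ≠ f b := fun a b h =>
    hind b b.2 a a.2 (h ▸ hadj b)
  let g : A → Sym2 (Xᶜ : Set V) := fun a => s(⟨a, haX a⟩, ⟨f a, hfX a⟩)
  have hshare : ∀ a b : A, ∀ v, v ∈ g a → v ∈ g b → a = b := by
    intro a b v hva hvb
    rcases Sym2.mem_iff.1 hva with h | h <;> rcases Sym2.mem_iff.1 hvb with h' | h' <;>
      have h2 := congrArg Subtype.val (h.symm.trans h') <;> simp only at h2
    · exact Subtype.ext h2
    · exact absurd h2 (hfA _ _)
    · exact absurd h2.symm (hfA _ _)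
    · exact hf h2
  have hg : Function.Injective g := fun a b h => hshare a b ⟨a, haX a⟩ (by simp [g])
    (by rw [← h]; simp [g])
  have hcardM : (Finset.univ.image g).card = nu T := by
    rw [Finset.card_image_of_injective _ hg, ← hAc]; simp
  rw [← hcardM]
  apply le_nu
  constructor
  · intro e he
    obtain ⟨a, -, rfl⟩ := Finset.mem_image.1 he
    exact hadj a
  · intro e he e' he' hne v hv hv'
    obtain ⟨a, -, rfl⟩ := Finset.mem_image.1 he
    obtain ⟨b, -, rfl⟩ := Finset.mem_image.1 he'
    exact hne (by rw [hshare a b v hv hv'])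

end URPaper
end
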